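/- arXiv:2203.09977 — 16 statements merged into one kernel-verified Lean document; each statement's English description precedes it below -/
import Mathlib

section
/- Let (f_n)_{n∈ℤ} and (p_n)_{n∈ℤ} be continuously differentiable functions from ℝ² (variables x, y) to A satisfying the non-Abelian Toda lattice ∂_y f_n = p_n − p_{n+1} and ∂_x p_n = f_n p_n − p_n f_{n−1} for all n ∈ ℤ. Suppose each p_n(x,y) is invertible in A and the constraint f_{n−1} + f_n = μ_n p_n^{−1} holds identically, where μ_n := εn + μ₀ with ε, μ₀ ∈ ℂ. Then for all n and all (x,y) one has ∂_x f_{n−1} + ∂_x f_n = f_{n−1}² − f_n². -/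
/-- For C¹ solutions `f, p : ℤ → ℝ² → A` of the non-Abelian Toda lattice
`∂_y f_n = p_n − p_{n+1}`, `∂_x p_n = f_n p_n − p_n f_{n−1}`, with each `p_n` invertible and
satisfying the constraint `f_{n−1} + f_n = μ_n p_n⁻¹` where `μ_n = εn + μ₀`, one has
`∂_x f_{n−1} + ∂_x f_n = f_{n−1}² − f_n²`. -/
theorem toda_constraint_fx {A : Type*} [NormedRing A] [NormedAlgebra ℂ A] [CompleteSpace A]
    (ε μ₀ : ℂ) (f p : ℤ → ℝ × ℝ → A)
    (hf : ∀ n, ContDiff ℝ 1 (f n)) (hp : ∀ n, ContDiff ℝ 1 (p n))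
    (hTLy : ∀ n, ∀ v : ℝ × ℝ, fderiv ℝ (f n) v (0, 1) = p n v - p (n + 1) v)
    (hTLx : ∀ n, ∀ v : ℝ × ℝ,
      fderiv ℝ (p n) v (1, 0) = f n v * p n v - p n v * f (n - 1) v)
    (hunit : ∀ n, ∀ v : ℝ × ℝ, IsUnit (p n v))
    (hcon : ∀ n : ℤ, ∀ v : ℝ × ℝ,
      f (n - 1) v + f n v = (ε * (n : ℂ) + μ₀) • Ring.inverse (p n v)) :
    ∀ n : ℤ, ∀ v : ℝ × ℝ,
      fderiv ℝ (f (n - 1)) v (1, 0) + fderiv ℝ (f n) v (1, 0)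
        = (f (n - 1) v) ^ 2 - (f n v) ^ 2 := by
  intro n v
  have hg := ((hf (n - 1)).differentiable one_ne_zero v).hasFDerivAt
  have hff := ((hf n).differentiable one_ne_zero v).hasFDerivAt
  have hpp := ((hp n).differentiable one_ne_zero v).hasFDerivAt
  have hsp : ∀ w, (f (n - 1) w + f n w) * p n w = (ε * (n : ℂ) + μ₀) • (1 : A) := by
    intro w
    rw [hcon n w, smul_mul_assoc, Ring.inverse_mul_cancel _ (hunit n w)]
  have hm := (hg.add hff).mul' hpp
  have hc : HasFDerivAt ((f (n - 1) + f n) * p n) (0 : ℝ × ℝ →L[ℝ] A) v := by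
    have : ((f (n - 1) + f n) * p n) = fun _ => (ε * (n : ℂ) + μ₀) • (1 : A) := by
      funext w
      exact hsp w
    rw [this]
    exact hasFDerivAt_const _ _
  have h0 := congrArg (fun L : ℝ × ℝ →L[ℝ] A => L (1, 0)) (hm.unique hc)
  simp [hTLx] at h0
  have h1 := hsp v
  have h2 : (f (n - 1) v + f n v) * p n v * f (n - 1) v
      = f (n - 1) v * ((f (n - 1) v + f n v) * p n v) := by
    rw [h1]; simp
  apply (hunit n v).mul_right_cancel
  rw [← sub_eq_zero]
  rw [← sub_eq_zero] at h2
  have h3 := congrArg₂ (· + ·) h0 h2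
  simp only [add_zero] at h3
  rw [← h3]
  noncomm_ring
end

section
/- Let ε, μ₀ ∈ ℂ and μ_n := εn + μ₀, and assume μ_n ≠ 0 for all n ∈ ℤ. Let (f_n)_{n∈ℤ} be continuously differentiable functions ℝ² → A such that f_{n−1} + f_n is invertible at every point, and suppose they satisfy ∂_x f_n + ∂_x f_{n+1} = f_n² − f_{n+1}² and ∂_y f_n = μ_n (f_{n−1}+f_n)^{−1} − μ_{n+1} (f_n+f_{n+1})^{−1} for all n. Define p_n := μ_n (f_{n−1}+f_n)^{−1}. Then (f_n, p_n) satisfy the non-Abelian Toda lattice ∂_y f_n = p_n − p_{n+1} and ∂_x p_n = f_n p_n − p_n f_{n−1} for all n, and the constraint f_{n−1} + f_n = μ_n p_n^{−1} holds. -/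
/-- If `μ_n = εn + μ₀ ≠ 0` for all `n` and the C¹ functions `f_n` with
`f_{n−1}+f_n` invertible satisfy `∂_x f_n + ∂_x f_{n+1} = f_n² − f_{n+1}²` and
`∂_y f_n = μ_n (f_{n−1}+f_n)⁻¹ − μ_{n+1}(f_n+f_{n+1})⁻¹`, then
`p_n := μ_n (f_{n−1}+f_n)⁻¹` together with `f_n` solves the non-Abelian Toda lattice and
the constraint `f_{n−1} + f_n = μ_n p_n⁻¹` holds. -/
theorem toda_from_reduced_system {A : Type*} [NormedRing A] [NormedAlgebra ℂ A]
    [CompleteSpace A] (ε μ₀ : ℂ) (hμ : ∀ n : ℤ, ε * (n : ℂ) + μ₀ ≠ 0)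
    (f : ℤ → ℝ × ℝ → A) (hf : ∀ n, ContDiff ℝ 1 (f n))
    (hunit : ∀ n : ℤ, ∀ v : ℝ × ℝ, IsUnit (f (n - 1) v + f n v))
    (hfx : ∀ n : ℤ, ∀ v : ℝ × ℝ,
      fderiv ℝ (f n) v (1, 0) + fderiv ℝ (f (n + 1)) v (1, 0)
        = (f n v) ^ 2 - (f (n + 1) v) ^ 2)
    (hfy : ∀ n : ℤ, ∀ v : ℝ × ℝ,
      fderiv ℝ (f n) v (0, 1)
        = (ε * (n : ℂ) + μ₀) • Ring.inverse (f (n - 1) v + f n v)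
          - (ε * ((n : ℂ) + 1) + μ₀) • Ring.inverse (f n v + f (n + 1) v)) :
    ∀ p : ℤ → ℝ × ℝ → A,
      (∀ n : ℤ, ∀ v : ℝ × ℝ,
        p n v = (ε * (n : ℂ) + μ₀) • Ring.inverse (f (n - 1) v + f n v)) →
      ∀ n : ℤ, ∀ v : ℝ × ℝ,
        fderiv ℝ (f n) v (0, 1) = p n v - p (n + 1) v ∧
        fderiv ℝ (p n) v (1, 0) = f n v * p n v - p n v * f (n - 1) v ∧
        f (n - 1) v + f n v = (ε * (n : ℂ) + μ₀) • Ring.inverse (p n v) := by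
  intro p hp n v
  obtain ⟨u, hu⟩ := hunit n v
  have hinv : Ring.inverse (f (n - 1) v + f n v) = ((u⁻¹ : Aˣ) : A) := by
    rw [← hu, Ring.inverse_unit]
  refine ⟨?_, ?_, ?_⟩
  · rw [hfy, hp, hp]
    simp
  · have h1 : ∀ m, HasFDerivAt (f m) (fderiv ℝ (f m) v) v := fun m =>
      (((hf m).differentiable (by norm_num)) v).hasFDerivAt
    have h2 := (h1 (n - 1)).add (h1 n)
    have h3 : HasFDerivAt (Ring.inverse : A → A)
        (-ContinuousLinearMap.mulLeftRight ℝ A ↑u⁻¹ ↑u⁻¹) ((f (n - 1) + f n) v) := by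
      have := hasFDerivAt_ringInverse (𝕜 := ℝ) u
      rw [hu] at this
      exact this
    have h4 := (h3.comp v h2).const_smul (ε * (n : ℂ) + μ₀)
    have hpn : p n = fun v => (ε * (n : ℂ) + μ₀) • Ring.inverse (f (n - 1) v + f n v) :=
      funext (hp n)
    have h4b : p n = (ε * (n : ℂ) + μ₀) • Ring.inverse ∘ (f (n - 1) + f n) := hpn
    rw [← h4b] at h4
    have h5 := h4.fderiv
    have h6 := hfx (n - 1) v
    rw [sub_add_cancel] at h6
    rw [h5, hp, hinv]
    simp only [smul_mul_assoc, mul_smul_comm, ← smul_sub]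
    change (ε * (n : ℂ) + μ₀) • (-((u⁻¹ : Aˣ) * (fderiv ℝ (f (n - 1)) v (1, 0) +
      fderiv ℝ (f n) v (1, 0)) * (u⁻¹ : Aˣ) : A)) = _
    rw [h6]
    congr 1
    have key : (f (n - 1) v) ^ 2 - (f n v) ^ 2 = f (n - 1) v * u - u * f n v := by
      rw [hu]; noncomm_ring
    rw [key, mul_sub, sub_mul]
    simp [mul_assoc]
  · rw [hp, hinv]
    have : Ring.inverse ((ε * (n : ℂ) + μ₀) • ((u⁻¹ : Aˣ) : A))
        = (ε * (n : ℂ) + μ₀)⁻¹ • (u : A) := by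
      let w : Aˣ := ⟨(ε * (n : ℂ) + μ₀) • ((u⁻¹ : Aˣ) : A), (ε * (n : ℂ) + μ₀)⁻¹ • (u : A),
        by simp [smul_smul, hμ n], by simp [smul_smul, hμ n]⟩
      exact Ring.inverse_unit w
    rw [this, smul_smul, mul_inv_cancel₀ (hμ n), one_smul, hu]
end

section
/- Let ε, μ₀ ∈ ℂ and μ_n := εn + μ₀. Let (f_n)_{n∈ℤ} be continuously differentiable functions ℝ² → A with f_{n−1} + f_n invertible at every point, satisfying ∂_x f_n + ∂_x f_{n+1} = f_n² − f_{n+1}² and ∂_y f_n = μ_n (f_{n−1}+f_n)^{−1} − μ_{n+1} (f_n+f_{n+1})^{−1} for all n. Then for every n the cross-derivative compatibility identity ∂_y (f_n² − f_{n+1}²) = ∂_x ( μ_n (f_{n−1}+f_n)^{−1} − μ_{n+2} (f_{n+1}+f_{n+2})^{−1} ) holds at every point. -/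
/-- For C¹ functions `f_n` with `f_{n−1}+f_n` invertible satisfying
`∂_x f_n + ∂_x f_{n+1} = f_n² − f_{n+1}²` and
`∂_y f_n = μ_n (f_{n−1}+f_n)⁻¹ − μ_{n+1}(f_n+f_{n+1})⁻¹` with `μ_n = εn + μ₀`, the
cross-derivative compatibility identity
`∂_y (f_n² − f_{n+1}²) = ∂_x (μ_n (f_{n−1}+f_n)⁻¹ − μ_{n+2}(f_{n+1}+f_{n+2})⁻¹)` holds. -/
theorem reduced_system_compatibility {A : Type*} [NormedRing A] [NormedAlgebra ℂ A]
    [CompleteSpace A] (ε μ₀ : ℂ)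
    (f : ℤ → ℝ × ℝ → A) (hf : ∀ n, ContDiff ℝ 1 (f n))
    (hunit : ∀ n : ℤ, ∀ v : ℝ × ℝ, IsUnit (f (n - 1) v + f n v))
    (hfx : ∀ n : ℤ, ∀ v : ℝ × ℝ,
      fderiv ℝ (f n) v (1, 0) + fderiv ℝ (f (n + 1)) v (1, 0)
        = (f n v) ^ 2 - (f (n + 1) v) ^ 2)
    (hfy : ∀ n : ℤ, ∀ v : ℝ × ℝ,
      fderiv ℝ (f n) v (0, 1)
        = (ε * (n : ℂ) + μ₀) • Ring.inverse (f (n - 1) v + f n v)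
          - (ε * ((n : ℂ) + 1) + μ₀) • Ring.inverse (f n v + f (n + 1) v)) :
    ∀ n : ℤ, ∀ v : ℝ × ℝ,
      fderiv ℝ (fun w => (f n w) ^ 2 - (f (n + 1) w) ^ 2) v (0, 1)
        = fderiv ℝ (fun w =>
            (ε * (n : ℂ) + μ₀) • Ring.inverse (f (n - 1) w + f n w)
              - (ε * ((n : ℂ) + 2) + μ₀) • Ring.inverse (f (n + 1) w + f (n + 2) w))
            v (1, 0) := by
  intro n v
  have hd : ∀ k, HasFDerivAt (f k) (fderiv ℝ (f k) v) v := fun k =>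
    (((hf k).differentiable (by norm_num)) v).hasFDerivAt
  have hsq : ∀ k, HasFDerivAt (fun w => (f k w) ^ 2) _ v := fun k => by
    simp only [pow_two]
    exact (hd k).mul' (hd k)
  have hu0 := hunit n v
  have hu1 : IsUnit (f n v + f (n + 1) v) := by
    have h := hunit (n + 1) v
    rwa [show n + 1 - 1 = n by ring] at h
  have hu2 : IsUnit (f (n + 1) v + f (n + 2) v) := by
    have h := hunit (n + 2) v
    rwa [show n + 2 - 1 = n + 1 by ring] at h
  have hinv : ∀ k l, IsUnit (f k v + f l v) → ∃ L : ℝ × ℝ →L[ℝ] A,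
      HasFDerivAt (fun w => Ring.inverse (f k w + f l w)) L v ∧
      ∀ t, L t = - (Ring.inverse (f k v + f l v) * (fderiv ℝ (f k) v t + fderiv ℝ (f l) v t)
        * Ring.inverse (f k v + f l v)) := by
    rintro k l ⟨u, hu⟩
    have h1 : HasFDerivAt Ring.inverse _ (f k v + f l v) := hu ▸ hasFDerivAt_ringInverse (𝕜 := ℝ) u
    have h2 : HasFDerivAt (fun w => f k w + f l w) _ v := (hd k).fun_add (hd l)
    refine ⟨_, HasFDerivAt.comp (g := Ring.inverse) (f := fun w => f k w + f l w) v h1 h2,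
      fun t => ?_⟩
    rw [← hu, Ring.inverse_unit]
    simp [mul_add, add_mul, add_comm]
  obtain ⟨L0, hL0, e0⟩ := hinv (n - 1) n hu0
  obtain ⟨L2, hL2, e2⟩ := hinv (n + 1) (n + 2) hu2
  have x0 := hfx (n - 1) v
  rw [show n - 1 + 1 = n by ring] at x0
  have x2 := hfx (n + 1) v
  rw [show n + 1 + 1 = n + 2 by ring] at x2
  have y0 := hfy n v
  have y1 := hfy (n + 1) v
  rw [show n + 1 - 1 = n by ring, show n + 1 + 1 = n + 2 by ring] at y1
  rw [((hsq n).fun_sub (hsq (n + 1))).fderiv,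
    ((hL0.fun_const_smul (ε * (n : ℂ) + μ₀)).fun_sub (hL2.fun_const_smul (ε * ((n : ℂ) + 2) + μ₀))).fderiv]
  simp only [ContinuousLinearMap.sub_apply, ContinuousLinearMap.add_apply,
    ContinuousLinearMap.smul_apply, e0, e2, x0, x2, y0, y1, smul_eq_mul, op_smul_eq_mul,
    MulOpposite.smul_eq_mul_unop, MulOpposite.unop_op]
  have p0 := Ring.inverse_mul_cancel _ hu0
  have p1 := Ring.mul_inverse_cancel _ hu0
  have q0 := Ring.inverse_mul_cancel _ hu1
  have q1 := Ring.mul_inverse_cancel _ hu1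
  have r0 := Ring.inverse_mul_cancel _ hu2
  have r1 := Ring.mul_inverse_cancel _ hu2
  generalize Ring.inverse (f (n - 1) v + f n v) = P at *
  generalize Ring.inverse (f n v + f (n + 1) v) = Q at *
  generalize Ring.inverse (f (n + 1) v + f (n + 2) v) = R at *
  generalize f (n - 1) v = a at *
  generalize f n v = b at *
  generalize f (n + 1) v = c at *
  generalize f (n + 2) v = d at *
  have k0 : -(P * (a ^ 2 - b ^ 2) * P) = b * P + P * b - 1 := by
    have : P * (a ^ 2 - b ^ 2) * P = (P * (a + b)) * ((a + b) * P) - (P * (a + b)) * (b * P)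
      - (P * b) * ((a + b) * P) := by noncomm_ring
    rw [this, p0, p1]; noncomm_ring
  have k2 : -(R * (c ^ 2 - d ^ 2) * R) = 1 - (c * R + R * c) := by
    have : R * (c ^ 2 - d ^ 2) * R = (R * (c + d)) * (c * R)
      + (R * c) * ((c + d) * R) - (R * (c + d)) * ((c + d) * R) := by noncomm_ring
    rw [this, r0, r1]; noncomm_ring
  rw [k0, k2]
  have q0' : Q * c = 1 - Q * b := by rw [← q0]; noncomm_ring
  have q1' : c * Q = 1 - b * Q := by rw [← q1]; noncomm_ring
  simp only [mul_sub, sub_mul, smul_mul_assoc, mul_smul_comm]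
  push_cast
  rw [q0', q1']
  module
end

section
/- Let (f_n)_{n∈ℤ}, (p_n)_{n∈ℤ} be continuously differentiable functions ℝ² → A satisfying the non-Abelian Toda lattice ∂_y f_n = p_n − p_{n+1}, ∂_x p_n = f_n p_n − p_n f_{n−1}, with each p_n invertible and the constraint f_{n−1} + f_n = μ_n p_n^{−1}, where μ_n := εn + μ₀ with ε, μ₀ ∈ ℂ. Fix κ ∈ ℂ and set h_n(x,y) := (−εy − κ)·1 ∈ A for all n. Then for all n and all (x,y): (i) ∂_x f_n + ∂_x f_{n+1} = f_n² − f_{n+1}² − h_n + h_{n+1}; (ii) ∂_x h_n = [f_n, h_n]; (iii) ∂_y h_n = p_n (f_{n−1}+f_n) − (f_n+f_{n+1}) p_{n+1}; (iv) h_n p_n − p_n h_{n−1} = 0. In other words, the stationary equations of the higher symmetry hold with f_{n,t} = p_{n,t} = 0 for the choice h_n = −εy − κ. -/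
/-- For C¹ solutions of the Toda lattice with the constraint
`f_{n−1}+f_n = μ_n p_n⁻¹`, `μ_n = εn+μ₀`, the stationary equations of the simplest
higher symmetry hold with `f_{n,t} = p_{n,t} = 0` for the choice `h_n = (−εy−κ)·1`. -/
theorem toda_constraint_stationary_symmetry {A : Type*} [NormedRing A] [NormedAlgebra ℂ A]
    [CompleteSpace A] (ε μ₀ κ : ℂ) (f p : ℤ → ℝ × ℝ → A)
    (hf : ∀ n, ContDiff ℝ 1 (f n)) (hp : ∀ n, ContDiff ℝ 1 (p n))
    (hTLy : ∀ n : ℤ, ∀ v : ℝ × ℝ, fderiv ℝ (f n) v (0, 1) = p n v - p (n + 1) v)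
    (hTLx : ∀ n : ℤ, ∀ v : ℝ × ℝ,
      fderiv ℝ (p n) v (1, 0) = f n v * p n v - p n v * f (n - 1) v)
    (hunit : ∀ n : ℤ, ∀ v : ℝ × ℝ, IsUnit (p n v))
    (hcon : ∀ n : ℤ, ∀ v : ℝ × ℝ,
      f (n - 1) v + f n v = (ε * (n : ℂ) + μ₀) • Ring.inverse (p n v))
    (h : ℤ → ℝ × ℝ → A)
    (hh : ∀ n : ℤ, ∀ v : ℝ × ℝ, h n v = (-(ε * (v.2 : ℂ)) - κ) • (1 : A)) :
    ∀ n : ℤ, ∀ v : ℝ × ℝ,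
      (fderiv ℝ (f n) v (1, 0) + fderiv ℝ (f (n + 1)) v (1, 0)
          = (f n v) ^ 2 - (f (n + 1) v) ^ 2 - h n v + h (n + 1) v) ∧
      (fderiv ℝ (h n) v (1, 0) = f n v * h n v - h n v * f n v) ∧
      (fderiv ℝ (h n) v (0, 1)
          = p n v * (f (n - 1) v + f n v) - (f n v + f (n + 1) v) * p (n + 1) v) ∧
      (h n v * p n v - p n v * h (n - 1) v = 0) := by
  intro n v
  have hsp : ∀ m : ℤ, ∀ w : ℝ × ℝ,
      (f (m - 1) w + f m w) * p m w = (ε * (m : ℂ) + μ₀) • (1 : A) := by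
    intro m w
    rw [hcon, smul_mul_assoc, Ring.inverse_mul_cancel _ (hunit m w)]
  have hps : ∀ m : ℤ, ∀ w : ℝ × ℝ,
      p m w * (f (m - 1) w + f m w) = (ε * (m : ℂ) + μ₀) • (1 : A) := by
    intro m w
    rw [hcon, mul_smul_comm, Ring.mul_inverse_cancel _ (hunit m w)]
  have hdf : ∀ m, HasFDerivAt (f m) (fderiv ℝ (f m) v) v := fun m =>
    ((hf m).differentiable one_ne_zero v).hasFDerivAt
  have hdp : ∀ m, HasFDerivAt (p m) (fderiv ℝ (p m) v) v := fun m =>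
    ((hp m).differentiable one_ne_zero v).hasFDerivAt
  have hdh : HasFDerivAt (h n)
      ((ContinuousLinearMap.snd ℝ ℝ ℝ).smulRight ((-ε) • (1 : A))) v := by
    have e : h n = fun w : ℝ × ℝ =>
        (ContinuousLinearMap.snd ℝ ℝ ℝ).smulRight ((-ε) • (1 : A)) w + (-κ) • (1 : A) := by
      funext w
      rw [hh, ContinuousLinearMap.smulRight_apply, ContinuousLinearMap.coe_snd',
        ← Complex.coe_smul, smul_smul, ← add_smul]
      congr 1
      ring
    rw [e]
    exact (ContinuousLinearMap.hasFDerivAt _).add_const _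
  refine ⟨?_, ?_, ?_, ?_⟩
  · have h1 := ((hdf n).add (hdf (n + 1))).mul' (hdp (n + 1))
    have e : (f n + f (n + 1)) * p (n + 1)
        = fun _ => (ε * ((n + 1 : ℤ) : ℂ) + μ₀) • (1 : A) := by
      funext w
      have := hsp (n + 1) w
      rw [add_sub_cancel_right] at this
      exact this
    rw [e] at h1
    have h2 := h1.unique (hasFDerivAt_const _ _)
    have h3 := congrArg (fun L => L ((1, 0) : ℝ × ℝ)) h2
    simp [hTLx] at h3
    have e1 := hsp (n + 1) v
    rw [add_sub_cancel_right] at e1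
    have key : (f n v + f (n + 1) v) * p (n + 1) v * f n v
        = f n v * ((f n v + f (n + 1) v) * p (n + 1) v) := by
      rw [e1, smul_mul_assoc, mul_smul_comm, one_mul, mul_one]
    have hz : (fderiv ℝ (f n) v (1, 0) + fderiv ℝ (f (n + 1)) v (1, 0)) * p (n + 1) v
        = ((f n v) ^ 2 - (f (n + 1) v) ^ 2) * p (n + 1) v := by
      rw [← sub_eq_zero, ← h3]
      have := sub_eq_zero.2 key
      rw [← sub_eq_zero, ← this]
      noncomm_ring
    rw [(hunit (n + 1) v).mul_right_cancel hz, hh, hh]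
    abel
  · rw [hdh.fderiv, hh]
    simp
  · have e1 := hsp (n + 1) v
    rw [add_sub_cancel_right] at e1
    rw [hdh.fderiv, hps, e1, ← sub_smul]
    simp
    rw [← neg_smul]
    congr 1
    ring
  · rw [hh, hh]
    simp
end

section
/- Let ε, μ₀ ∈ ℂ, μ_n := εn + μ₀, and let (f_n)_{n∈ℤ}, (p_n)_{n∈ℤ} be continuously differentiable functions ℝ² → A with each p_n invertible. For λ ∈ ℂ∖{0} define the 2×2 matrices over A: U_n = [[f_n, λ],[λ, −f_n]], V_n = λ^{−1}·[[ (μ_n+μ_{n+1})/(2λ), p_n ],[ p_{n+1}, 0 ]], W_n = [[0, λ],[λ, −f_n−f_{n+1}]]. Then the zero curvature equations ∂_x W_n = U_{n+1} W_n − W_n U_n, ∂_y W_n + (ε/(2λ)) ∂_λ W_n = V_{n+1} W_n − W_n V_n, and ∂_y U_n + (ε/(2λ)) ∂_λ U_n = ∂_x V_n + [V_n, U_n] hold for all n, all (x,y), and all λ ≠ 0 if and only if (f_n, p_n) satisfy the Toda lattice ∂_y f_n = p_n − p_{n+1}, ∂_x p_n = f_n p_n − p_n f_{n−1} together with the constraint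 f_{n−1} + f_n = μ_n p_n^{−1} for all n. -/
set_option linter.unusedSimpArgs false

theorem toda_lin {A : Type*} [Ring A] [Algebra ℂ A] {a b c d : A} (h : a = b) (k : ℂ)
    (e : c - d = k • (a - b)) : c = d := by
  rw [h, sub_self, smul_zero] at e
  exact sub_eq_zero.1 e

/-- The zero curvature equations with variable spectral parameter
(`∂_x W_n = U_{n+1}W_n − W_nU_n`, `∂_y W_n + (ε/(2λ))∂_λ W_n = V_{n+1}W_n − W_nV_n`,
`∂_y U_n + (ε/(2λ))∂_λ U_n = ∂_x V_n + [V_n, U_n]`) for the matrices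
`U_n = [[f_n, λ],[λ, −f_n]]`, `V_n = λ⁻¹[[(μ_n+μ_{n+1})/(2λ), p_n],[p_{n+1}, 0]]`,
`W_n = [[0, λ],[λ, −f_n−f_{n+1}]]` hold for all `n`, `(x,y)` and `λ ≠ 0` if and only if
`(f_n, p_n)` satisfy the Toda lattice together with the constraint
`f_{n−1}+f_n = μ_n p_n⁻¹`, where `μ_n = εn + μ₀`. -/
theorem toda_zero_curvature_representation {A : Type*} [NormedRing A] [NormedAlgebra ℂ A]
    [CompleteSpace A] (ε μ₀ : ℂ) (f p : ℤ → ℝ × ℝ → A)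
    (hf : ∀ n, ContDiff ℝ 1 (f n)) (hp : ∀ n, ContDiff ℝ 1 (p n))
    (hunit : ∀ n : ℤ, ∀ v : ℝ × ℝ, IsUnit (p n v))
    (U V W : ℤ → ℝ × ℝ → ℂ → Matrix (Fin 2) (Fin 2) A)
    (hU : ∀ n : ℤ, ∀ v : ℝ × ℝ, ∀ l : ℂ,
      U n v l = !![f n v, l • (1 : A); l • (1 : A), -f n v])
    (hV : ∀ n : ℤ, ∀ v : ℝ × ℝ, ∀ l : ℂ,
      V n v l = l⁻¹ • !![(((ε * (n : ℂ) + μ₀) + (ε * ((n : ℂ) + 1) + μ₀)) / (2 * l)) • (1 : A),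
        p n v; p (n + 1) v, 0])
    (hW : ∀ n : ℤ, ∀ v : ℝ × ℝ, ∀ l : ℂ,
      W n v l = !![0, l • (1 : A); l • (1 : A), -f n v - f (n + 1) v]) :
    (∀ n : ℤ, ∀ v : ℝ × ℝ, ∀ l : ℂ, l ≠ 0 → ∀ i j : Fin 2,
        (fderiv ℝ (fun w => W n w l i j) v (1, 0)
            = (U (n + 1) v l * W n v l - W n v l * U n v l) i j) ∧
        (fderiv ℝ (fun w => W n w l i j) v (0, 1)
              + (ε / (2 * l)) • fderiv ℂ (fun m => W n v m i j) l 1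
            = (V (n + 1) v l * W n v l - W n v l * V n v l) i j) ∧
        (fderiv ℝ (fun w => U n w l i j) v (0, 1)
              + (ε / (2 * l)) • fderiv ℂ (fun m => U n v m i j) l 1
            = fderiv ℝ (fun w => V n w l i j) v (1, 0)
              + (V n v l * U n v l - U n v l * V n v l) i j))
      ↔
    (∀ n : ℤ, ∀ v : ℝ × ℝ,
        fderiv ℝ (f n) v (0, 1) = p n v - p (n + 1) v ∧
        fderiv ℝ (p n) v (1, 0) = f n v * p n v - p n v * f (n - 1) v ∧
        f (n - 1) v + f n v = (ε * (n : ℂ) + μ₀) • Ring.inverse (p n v)) := by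
  have hfd : ∀ n v, DifferentiableAt ℝ (f n) v := fun n v =>
    ((hf n).differentiable (by norm_num)) v
  have hpd : ∀ n v, DifferentiableAt ℝ (p n) v := fun n v =>
    ((hp n).differentiable (by norm_num)) v
  have key : ∀ (n : ℤ) (v : ℝ × ℝ) (l : ℂ), l ≠ 0 → ((∀ i j : Fin 2,
        (fderiv ℝ (fun w => W n w l i j) v (1, 0)
            = (U (n + 1) v l * W n v l - W n v l * U n v l) i j) ∧
        (fderiv ℝ (fun w => W n w l i j) v (0, 1)
              + (ε / (2 * l)) • fderiv ℂ (fun m => W n v m i j) l 1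
            = (V (n + 1) v l * W n v l - W n v l * V n v l) i j) ∧
        (fderiv ℝ (fun w => U n w l i j) v (0, 1)
              + (ε / (2 * l)) • fderiv ℂ (fun m => U n v m i j) l 1
            = fderiv ℝ (fun w => V n w l i j) v (1, 0)
              + (V n v l * U n v l - U n v l * V n v l) i j)) ↔
      (fderiv ℝ (f n) v (1, 0) + fderiv ℝ (f (n+1)) v (1, 0) =
          f n v * f n v - f (n+1) v * f (n+1) v ∧
       fderiv ℝ (f n) v (0, 1) + fderiv ℝ (f (n+1)) v (0, 1) = p n v - p (n+2) v ∧
       p (n+1) v * (f n v + f (n+1) v) = (ε * ((n+1 : ℤ) : ℂ) + μ₀) • (1 : A) ∧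
       (f n v + f (n+1) v) * p (n+1) v = (ε * ((n+1 : ℤ) : ℂ) + μ₀) • (1 : A) ∧
       fderiv ℝ (f n) v (0, 1) = p n v - p (n+1) v ∧
       fderiv ℝ (p n) v (1, 0) = f n v * p n v + p n v * f n v - (ε * (n : ℂ) + μ₀) • (1 : A) ∧
       fderiv ℝ (p (n+1)) v (1, 0) =
         (ε * ((n+1 : ℤ) : ℂ) + μ₀) • (1 : A) - f n v * p (n+1) v - p (n+1) v * f n v)) := by
    intro n v l hl
    have d1 : ∀ u, fderiv ℝ (fun w => -f n w - f (n+1) w) v u =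
        - fderiv ℝ (f n) v u - fderiv ℝ (f (n+1)) v u := by
      intro u
      rw [fderiv_fun_sub (hfd n v).fun_neg (hfd (n+1) v), fderiv_fun_neg]; rfl
    have d2 : ∀ u, fderiv ℝ (fun w => -f n w) v u = - fderiv ℝ (f n) v u := by
      intro u
      rw [fderiv_fun_neg]; rfl
    have d3 : ∀ k u, fderiv ℝ (fun w => l⁻¹ • p k w) v u = l⁻¹ • fderiv ℝ (p k) v u := by
      intro k u
      rw [fderiv_fun_const_smul (hpd k v)]; rfl
    have d4 : fderiv ℂ (fun m : ℂ => m • (1 : A)) l 1 = 1 := by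
      rw [fderiv_smul_const differentiableAt_fun_id]; simp
    have e2 : n + 1 + 1 = n + 2 := by ring
    simp only [hU, hV, hW, Fin.forall_fin_two, Matrix.sub_apply, Matrix.mul_apply,
      Fin.sum_univ_two, Matrix.smul_apply, Matrix.of_apply, Matrix.cons_val_zero,
      Matrix.cons_val_one, Matrix.cons_val', Matrix.cons_val_fin_one, d1, d2, d3, d4,
      fderiv_fun_const, e2, Pi.zero_apply, zero_apply]
    simp only [smul_zero, mul_zero, zero_mul, zero_add, add_zero, smul_mul_assoc, mul_smul_comm,
      one_mul, mul_one, smul_smul, sub_self, smul_sub, smul_add, smul_neg, mul_neg, neg_mul]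
    have tr : (0 : A) = 0 := rfl
    constructor
    · rintro ⟨⟨⟨-, -, a3⟩, -, b2, b3⟩, ⟨-, c2, c3⟩, g1, g2, g3⟩
      refine ⟨?_, ?_, ?_, ?_, ?_, ?_, ?_⟩
      · exact toda_lin g1 (-1) (by
        try simp only [mul_add, add_mul, mul_sub, sub_mul, neg_mul, mul_neg, Int.cast_add,
          Int.cast_one]
        match_scalars <;> field_simp <;> ring)
      · exact toda_lin g2 (-1) (by
        try simp only [mul_add, add_mul, mul_sub, sub_mul, neg_mul, mul_neg, Int.cast_add,
          Int.cast_one]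
        match_scalars <;> field_simp <;> ring)
      · exact toda_lin b2 (l) (by
        try simp only [mul_add, add_mul, mul_sub, sub_mul, neg_mul, mul_neg, Int.cast_add,
          Int.cast_one]
        match_scalars <;> field_simp <;> ring)
      · exact toda_lin c2 (-l) (by
        try simp only [mul_add, add_mul, mul_sub, sub_mul, neg_mul, mul_neg, Int.cast_add,
          Int.cast_one]
        match_scalars <;> field_simp <;> ring)
      · exact toda_lin a3 (1) (by
        try simp only [mul_add, add_mul, mul_sub, sub_mul, neg_mul, mul_neg, Int.cast_add,
          Int.cast_one]
        match_scalars <;> field_simp <;> ring)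
      · exact toda_lin b3 (-l) (by
        try simp only [mul_add, add_mul, mul_sub, sub_mul, neg_mul, mul_neg, Int.cast_add,
          Int.cast_one]
        match_scalars <;> field_simp <;> ring)
      · exact toda_lin c3 (-l) (by
        try simp only [mul_add, add_mul, mul_sub, sub_mul, neg_mul, mul_neg, Int.cast_add,
          Int.cast_one]
        match_scalars <;> field_simp <;> ring)
    · rintro ⟨h1, h2, h3, h4, h5, h6, h7⟩
      refine ⟨⟨⟨trivial, ?_, ?_⟩, ?_, ?_, ?_⟩, ⟨?_, ?_, ?_⟩, ?_, ?_, ?_⟩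
      · exact toda_lin tr (0) (by
        try simp only [mul_add, add_mul, mul_sub, sub_mul, neg_mul, mul_neg, Int.cast_add,
          Int.cast_one]
        match_scalars <;> field_simp <;> ring)
      · exact toda_lin h5 (1) (by
        try simp only [mul_add, add_mul, mul_sub, sub_mul, neg_mul, mul_neg, Int.cast_add,
          Int.cast_one]
        match_scalars <;> field_simp <;> ring)
      · exact toda_lin tr (0) (by
        try simp only [mul_add, add_mul, mul_sub, sub_mul, neg_mul, mul_neg, Int.cast_add,
          Int.cast_one]
        match_scalars <;> field_simp <;> ring)
      · exact toda_lin h3 (l⁻¹) (by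
        try simp only [mul_add, add_mul, mul_sub, sub_mul, neg_mul, mul_neg, Int.cast_add,
          Int.cast_one]
        match_scalars <;> field_simp <;> ring)
      · exact toda_lin h6 (-l⁻¹) (by
        try simp only [mul_add, add_mul, mul_sub, sub_mul, neg_mul, mul_neg, Int.cast_add,
          Int.cast_one]
        match_scalars <;> field_simp <;> ring)
      · exact toda_lin tr (0) (by
        try simp only [mul_add, add_mul, mul_sub, sub_mul, neg_mul, mul_neg, Int.cast_add,
          Int.cast_one]
        match_scalars <;> field_simp <;> ring)
      · exact toda_lin h4 (-l⁻¹) (by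
        try simp only [mul_add, add_mul, mul_sub, sub_mul, neg_mul, mul_neg, Int.cast_add,
          Int.cast_one]
        match_scalars <;> field_simp <;> ring)
      · exact toda_lin h7 (-l⁻¹) (by
        try simp only [mul_add, add_mul, mul_sub, sub_mul, neg_mul, mul_neg, Int.cast_add,
          Int.cast_one]
        match_scalars <;> field_simp <;> ring)
      · exact toda_lin h1 (-1) (by
        try simp only [mul_add, add_mul, mul_sub, sub_mul, neg_mul, mul_neg, Int.cast_add,
          Int.cast_one]
        match_scalars <;> field_simp <;> ring)
      · exact toda_lin h2 (-1) (by
        try simp only [mul_add, add_mul, mul_sub, sub_mul, neg_mul, mul_neg, Int.cast_add,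
          Int.cast_one]
        match_scalars <;> field_simp <;> ring)
      · exact toda_lin h5 (-1) (by
        try simp only [mul_add, add_mul, mul_sub, sub_mul, neg_mul, mul_neg, Int.cast_add,
          Int.cast_one]
        match_scalars <;> field_simp <;> ring)
  constructor
  · intro H n v
    have K := fun n => (key n v 1 one_ne_zero).1 (H n v 1 one_ne_zero)
    obtain ⟨-, -, h3, h4, -, -, h7⟩ := K (n - 1)
    obtain ⟨-, -, -, -, h5, -, -⟩ := K n
    rw [sub_add_cancel] at h3 h4 h7
    refine ⟨h5, ?_, ?_⟩
    · rw [h7, ← h4]; noncomm_ring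
    · have := congrArg (fun z => Ring.inverse (p n v) * z) h3
      simp only [← mul_assoc, Ring.inverse_mul_cancel _ (hunit n v), one_mul] at this
      rw [this, mul_smul_comm, mul_one]
  · intro H n v l hl
    rw [key n v l hl]
    have C : ∀ w, p (n+1) w * (f n w + f (n+1) w) = (ε * ((n+1 : ℤ) : ℂ) + μ₀) • (1 : A) := by
      intro w
      have := (H (n+1) w).2.2
      rw [add_sub_cancel_right] at this
      rw [this, mul_smul_comm, Ring.mul_inverse_cancel _ (hunit _ w)]
    have C' : ∀ n, (f (n-1) v + f n v) * p n v = (ε * (n : ℂ) + μ₀) • (1 : A) := by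
      intro n
      rw [(H n v).2.2, smul_mul_assoc, Ring.inverse_mul_cancel _ (hunit _ v)]
    have C2 : p n v * (f (n-1) v + f n v) = (ε * (n : ℂ) + μ₀) • (1 : A) := by
      rw [(H n v).2.2, mul_smul_comm, Ring.mul_inverse_cancel _ (hunit _ v)]
    have C1 := C' (n+1)
    obtain ⟨a1, a2, -⟩ := H n v
    obtain ⟨b1, b2, -⟩ := H (n+1) v
    rw [add_sub_cancel_right] at C1 b2
    have e2 : n + 1 + 1 = n + 2 := by ring
    rw [e2] at b1
    refine ⟨?_, ?_, C v, C1, a1, ?_, ?_⟩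
    · have hd := ((hpd (n+1) v).hasFDerivAt.mul' ((hfd n v).hasFDerivAt.add
        (hfd (n+1) v).hasFDerivAt))
      have hc : HasFDerivAt (p (n+1) * (f n + f (n+1))) (0 : ℝ × ℝ →L[ℝ] A) v := by
        have : p (n+1) * (f n + f (n+1)) = fun _ => (ε * ((n+1 : ℤ) : ℂ) + μ₀) • (1 : A) :=
          funext C
        rw [this]; exact hasFDerivAt_const _ _
      have E := congrArg (fun L => L ((1 : ℝ), (0 : ℝ))) (hd.unique hc)
      simp at E
      rw [b2] at E
      apply (hunit (n+1) v).mul_left_cancel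
      have F : f (n+1) v * (p (n+1) v * (f n v + f (n+1) v)) =
          (p (n+1) v * (f n v + f (n+1) v)) * f (n+1) v := by
        rw [C v, mul_smul_comm, smul_mul_assoc, mul_one, one_mul]
      rw [← sub_eq_zero] at E F ⊢
      rw [← sub_eq_zero.2 (E.trans F.symm)]
      noncomm_ring
    · rw [a1, b1]; abel
    · rw [a2, ← C2]; noncomm_ring
    · rw [b2, ← C1]; noncomm_ring
end

section
/- Let μ, ν ∈ ℂ and let f, p, q : ℝ² → A be twice continuously differentiable with q(x,y) invertible at every point, satisfying the system ∂_y f = p − q, ∂_x p = fp + pf − μ, ∂_x q = −fq − qf + ν. Define p̃ := q, q̃ := p + ν q^{−1} (∂_y q) q^{−1}, f̃ := −f + ν q^{−1}, and μ̃ := ν, ν̃ := −μ + 2ν. Then ∂_y f̃ = p̃ − q̃, ∂_x p̃ = f̃ p̃ + p̃ f̃ − μ̃, and ∂_x q̃ = −f̃ q̃ − q̃ f̃ + ν̃ at every point. -/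
/-- The Bäcklund transformation `p̃ = q`, `q̃ = p + ν q⁻¹ q_y q⁻¹`,
`f̃ = −f + ν q⁻¹`, `μ̃ = ν`, `ν̃ = −μ + 2ν` maps C² solutions of the system
`f_y = p − q`, `p_x = fp + pf − μ`, `q_x = −fq − qf + ν` to solutions of the same
system with the new parameters. -/
theorem pumped_MB_Backlund {A : Type*} [NormedRing A] [NormedAlgebra ℂ A] [CompleteSpace A]
    (μ ν : ℂ) (f p q : ℝ × ℝ → A)
    (hf : ContDiff ℝ 2 f) (hp : ContDiff ℝ 2 p) (hq : ContDiff ℝ 2 q)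
    (hqu : ∀ v : ℝ × ℝ, IsUnit (q v))
    (hfy : ∀ v : ℝ × ℝ, fderiv ℝ f v (0, 1) = p v - q v)
    (hpx : ∀ v : ℝ × ℝ, fderiv ℝ p v (1, 0) = f v * p v + p v * f v - μ • (1 : A))
    (hqx : ∀ v : ℝ × ℝ, fderiv ℝ q v (1, 0) = -(f v * q v) - q v * f v + ν • (1 : A))
    (ft pt qt : ℝ × ℝ → A)
    (hft : ∀ v : ℝ × ℝ, ft v = -f v + ν • Ring.inverse (q v))
    (hpt : ∀ v : ℝ × ℝ, pt v = q v)
    (hqt : ∀ v : ℝ × ℝ, qt v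
      = p v + ν • (Ring.inverse (q v) * fderiv ℝ q v (0, 1) * Ring.inverse (q v))) :
    ∀ v : ℝ × ℝ,
      fderiv ℝ ft v (0, 1) = pt v - qt v ∧
      fderiv ℝ pt v (1, 0) = ft v * pt v + pt v * ft v - ν • (1 : A) ∧
      fderiv ℝ qt v (1, 0)
        = -(ft v * qt v) - qt v * ft v + (-μ + 2 * ν) • (1 : A) := by
  have hfd : ∀ v, HasFDerivAt f (fderiv ℝ f v) v := fun v =>
    (hf.differentiable (by norm_num) v).hasFDerivAt
  have hpd : ∀ v, HasFDerivAt p (fderiv ℝ p v) v := fun v =>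
    (hp.differentiable (by norm_num) v).hasFDerivAt
  have hqd : ∀ v, HasFDerivAt q (fderiv ℝ q v) v := fun v =>
    (hq.differentiable (by norm_num) v).hasFDerivAt
  have hq1 : ContDiff ℝ 1 (fderiv ℝ q) := hq.fderiv_right (by norm_num)
  have hqdd : ∀ v, HasFDerivAt (fderiv ℝ q) (fderiv ℝ (fderiv ℝ q) v) v := fun v =>
    (hq1.differentiable (by norm_num) v).hasFDerivAt
  have hsx : ∀ v e : ℝ × ℝ, HasFDerivAt (fun w => fderiv ℝ q w e)
      ((fderiv ℝ (fderiv ℝ q) v).flip e) v := by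
    intro v e
    have := (hqdd v).clm_apply (hasFDerivAt_const e v)
    refine this.congr_fderiv ?_
    ext <;> simp
  have hrd : ∀ v, ∃ L : ℝ × ℝ →L[ℝ] A, HasFDerivAt (fun w => Ring.inverse (q w)) L v ∧
      ∀ e, L e = -(Ring.inverse (q v) * fderiv ℝ q v e * Ring.inverse (q v)) := by
    intro v
    obtain ⟨u, hu⟩ := hqu v
    have h1 := hasFDerivAt_ringInverse (𝕜 := ℝ) u
    rw [hu] at h1
    refine ⟨_, h1.comp v (hqd v), ?_⟩
    intro e
    simp [← hu]
  intro v
  obtain ⟨L, hL, hLe⟩ := hrd v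
  have hsymm : fderiv ℝ (fderiv ℝ q) v (1, 0) (0, 1) = fderiv ℝ (fderiv ℝ q) v (0, 1) (1, 0) :=
    (hq.contDiffAt.isSymmSndFDerivAt (by simp)) _ _
  have hqxy : fderiv ℝ (fderiv ℝ q) v (0, 1) (1, 0) =
      -((p v - q v) * q v + f v * fderiv ℝ q v (0, 1))
       - (fderiv ℝ q v (0, 1) * f v + q v * (p v - q v)) := by
    have h1 := hsx v (1, 0)
    have h2 := (((hfd v).mul' (hqd v)).neg.sub ((hqd v).mul' (hfd v))).add_const (ν • (1 : A))
    have h3 : (fun w => fderiv ℝ q w (1, 0)) =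
        fun w => -(f w * q w) - q w * f w + ν • (1 : A) := funext hqx
    rw [h3] at h1
    have h4 := congrArg (fun T : ℝ × ℝ →L[ℝ] A => T (0, 1)) (h1.unique h2)
    simp [hfy] at h4
    rw [h4]
    noncomm_ring
  have hrq : Ring.inverse (q v) * q v = 1 := Ring.inverse_mul_cancel _ (hqu v)
  have hqr : q v * Ring.inverse (q v) = 1 := Ring.mul_inverse_cancel _ (hqu v)
  have hrq' : ∀ z, Ring.inverse (q v) * (q v * z) = z := fun z => by
    rw [← mul_assoc, hrq, one_mul]
  have hqr' : ∀ z, q v * (Ring.inverse (q v) * z) = z := fun z => by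
    rw [← mul_assoc, hqr, one_mul]
  have eft : ft = fun w => -f w + ν • Ring.inverse (q w) := funext hft
  have ept : pt = q := funext hpt
  have eqt : qt = fun w => p w + ν • (Ring.inverse (q w) * fderiv ℝ q w (0, 1)
    * Ring.inverse (q w)) := funext hqt
  refine ⟨?_, ?_, ?_⟩
  · have h := (hfd v).neg.add (hL.const_smul ν)
    rw [hpt, hqt, eft]
    refine (congrArg (fun T : ℝ × ℝ →L[ℝ] A => T (0, 1)) h.fderiv).trans ?_
    simp [hfy, hLe]
    abel
  · rw [ept, hft, hqx]
    simp only [add_mul, mul_add, smul_mul_assoc, mul_smul_comm, hrq, hqr, neg_mul, mul_neg]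
    abel
  · have h := (hpd v).add (((hL.mul' (hsx v (0, 1))).mul' hL).const_smul ν)
    rw [hft, hqt, eqt]
    refine (congrArg (fun T : ℝ × ℝ →L[ℝ] A => T (1, 0)) h.fderiv).trans ?_
    simp [hpx, hLe, hqx, hsymm, hqxy]
    simp only [add_mul, mul_add, sub_mul, mul_sub, smul_mul_assoc, mul_smul_comm, hrq, hqr,
      hrq', hqr', neg_mul, mul_neg, mul_assoc, mul_one, one_mul]
    module
end

section
/- Let μ, ν ∈ ℂ and let f, p, q : ℝ² → A be continuously differentiable. For λ ∈ ℂ∖{0} define U = [[f, λ],[λ, −f]] and V = λ^{−1}·[[ (μ+ν)/(2λ), p ],[ q, 0 ]], 2×2 matrices over A. Then the equation ∂_y U + ((ν−μ)/(2λ)) ∂_λ U = ∂_x V + [V, U] holds for all (x,y) and all λ ≠ 0 if and only if f, p, q satisfy the system ∂_y f = p − q, ∂_x p = fp + pf − μ, ∂_x q = −fq − qf + ν. -/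
/-- The zero curvature equation `∂_y U + ((ν−μ)/(2λ)) ∂_λ U = ∂_x V + [V, U]`
with `U = [[f, λ],[λ, −f]]`, `V = λ⁻¹[[(μ+ν)/(2λ), p],[q, 0]]` holds for all `(x,y)` and
`λ ≠ 0` if and only if `f, p, q` satisfy `f_y = p − q`, `p_x = fp + pf − μ`,
`q_x = −fq − qf + ν`. -/
theorem pumped_MB_zero_curvature {A : Type*} [NormedRing A] [NormedAlgebra ℂ A]
    [CompleteSpace A] (μ ν : ℂ) (f p q : ℝ × ℝ → A)
    (hf : ContDiff ℝ 1 f) (hp : ContDiff ℝ 1 p) (hq : ContDiff ℝ 1 q)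
    (U V : ℝ × ℝ → ℂ → Matrix (Fin 2) (Fin 2) A)
    (hU : ∀ v : ℝ × ℝ, ∀ l : ℂ, U v l = !![f v, l • (1 : A); l • (1 : A), -f v])
    (hV : ∀ v : ℝ × ℝ, ∀ l : ℂ,
      V v l = l⁻¹ • !![((μ + ν) / (2 * l)) • (1 : A), p v; q v, 0]) :
    (∀ v : ℝ × ℝ, ∀ l : ℂ, l ≠ 0 → ∀ i j : Fin 2,
        fderiv ℝ (fun w => U w l i j) v (0, 1)
            + ((ν - μ) / (2 * l)) • fderiv ℂ (fun m => U v m i j) l 1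
          = fderiv ℝ (fun w => V w l i j) v (1, 0)
            + (V v l * U v l - U v l * V v l) i j)
      ↔
    (∀ v : ℝ × ℝ,
        fderiv ℝ f v (0, 1) = p v - q v ∧
        fderiv ℝ p v (1, 0) = f v * p v + p v * f v - μ • (1 : A) ∧
        fderiv ℝ q v (1, 0) = -(f v * q v) - q v * f v + ν • (1 : A)) := by
  have key : ∀ v : ℝ × ℝ, ∀ l : ℂ, l ≠ 0 →
      ((∀ i j : Fin 2,
        fderiv ℝ (fun w => U w l i j) v (0, 1)
            + ((ν - μ) / (2 * l)) • fderiv ℂ (fun m => U v m i j) l 1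
          = fderiv ℝ (fun w => V w l i j) v (1, 0)
            + (V v l * U v l - U v l * V v l) i j) ↔
      (fderiv ℝ f v (0, 1) = p v - q v ∧
        fderiv ℝ p v (1, 0) = f v * p v + p v * f v - μ • (1 : A) ∧
        fderiv ℝ q v (1, 0) = -(f v * q v) - q v * f v + ν • (1 : A))) := by
    intro v l hl
    have dp : DifferentiableAt ℝ p v := (hp.differentiable one_ne_zero) v
    have dq : DifferentiableAt ℝ q v := (hq.differentiable one_ne_zero) v
    have e1 : fderiv ℝ (fun w => l⁻¹ • p w) v (1, 0) = l⁻¹ • fderiv ℝ p v (1, 0) := by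
      rw [fderiv_fun_const_smul dp]; rfl
    have e2 : fderiv ℝ (fun w => l⁻¹ • q w) v (1, 0) = l⁻¹ • fderiv ℝ q v (1, 0) := by
      rw [fderiv_fun_const_smul dq]; rfl
    have e3 : fderiv ℂ (fun m : ℂ => m • (1 : A)) l 1 = 1 := by
      rw [((hasDerivAt_id' l).smul_const (1 : A)).hasFDerivAt.fderiv]; simp
    have e4 : fderiv ℝ (fun w => - f w) v (0, 1) = - fderiv ℝ f v (0, 1) := by
      rw [fderiv_fun_neg]; rfl
    have inj : ∀ a b : A, a = b ↔ l • a = l • b := fun a b =>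
      ⟨fun h => by rw [h], fun h => smul_right_injective A hl h⟩
    have h1 : l * ((ν - μ) / (2 * l)) = (ν - μ) / 2 := by field_simp
    have h2 : l * (l⁻¹ * (l * ((μ + ν) / (2 * l)))) = (μ + ν) / 2 := by field_simp
    have h3 : l * l⁻¹ = 1 := mul_inv_cancel₀ hl
    have h4 : l⁻¹ * l = 1 := inv_mul_cancel₀ hl
    have E00 : (V v l * U v l - U v l * V v l) 0 0 = p v - q v := by
      rw [hU, hV]
      simp [Matrix.mul_apply, Fin.sum_univ_two, smul_smul, h3, h4]
    have E11 : (V v l * U v l - U v l * V v l) 1 1 = q v - p v := by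
      rw [hU, hV]
      simp [Matrix.mul_apply, Fin.sum_univ_two, smul_smul, h3, h4]
    have E01 : l • (V v l * U v l - U v l * V v l) 0 1
        = ((μ + ν) / 2) • (1 : A) - p v * f v - f v * p v := by
      have h5 : l * (l⁻¹ * ((μ + ν) / (2 * l)) * l) = (μ + ν) / 2 := by field_simp
      rw [hU, hV]
      simp [Matrix.mul_apply, Fin.sum_univ_two, smul_smul, smul_sub, smul_add, h3, h5, -mul_inv_rev]
      abel
    have E10 : l • (V v l * U v l - U v l * V v l) 1 0
        = q v * f v + f v * q v - ((μ + ν) / 2) • (1 : A) := by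
      have h5 : l * (l * (l⁻¹ * ((μ + ν) / (2 * l)))) = (μ + ν) / 2 := by field_simp
      rw [hU, hV]
      simp [Matrix.mul_apply, Fin.sum_univ_two, smul_smul, smul_sub, smul_add, h3, h5, -mul_inv_rev]
      abel
    have hc1 : (ν - μ) / 2 = (μ + ν) / 2 - μ := by ring
    have hc2 : (ν - μ) / 2 = ν - (μ + ν) / 2 := by ring
    simp only [Fin.forall_fin_two]
    rw [E00, E11, inj _ (_ + (V v l * U v l - U v l * V v l) 0 1),
      inj _ (_ + (V v l * U v l - U v l * V v l) 1 0), smul_add, smul_add l, smul_add l,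
      smul_add l, E01, E10]
    simp only [hU, hV, Matrix.smul_apply, Matrix.of_apply, Matrix.cons_val', Matrix.cons_val_zero,
      Matrix.cons_val_one, Matrix.cons_val_fin_one, e1, e2, e3, e4, smul_smul, h1, h3, one_smul,
      smul_zero, fderiv_fun_const, Pi.zero_apply, _root_.zero_apply, zero_add, add_zero]
    constructor
    · rintro ⟨⟨a, b⟩, c, d⟩
      refine ⟨a, ?_, ?_⟩
      · rw [hc1, sub_smul] at b
        rw [← sub_eq_zero] at b ⊢
        rw [← neg_eq_zero, ← b]; abel
      · rw [hc2, sub_smul] at c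
        rw [← sub_eq_zero] at c ⊢
        rw [← neg_eq_zero, ← c]; abel
    · rintro ⟨a, b, c⟩
      refine ⟨⟨a, ?_⟩, ?_, ?_⟩
      · rw [b, hc1, sub_smul]; abel
      · rw [c, hc2, sub_smul]; abel
      · rw [a]; abel
  constructor
  · intro h v
    exact (key v 1 one_ne_zero).1 (h v 1 one_ne_zero)
  · intro h v l hl
    exact (key v l hl).2 (h v)
end

section
/- Let μ, ν ∈ ℂ and let f, p, q : ℝ² → A be twice continuously differentiable with q invertible at every point, satisfying ∂_y f = p − q, ∂_x p = fp + pf − μ, ∂_x q = −fq − qf + ν. Define f̃ := −f + ν q^{−1}, p̃ := q, q̃ := p + ν q^{−1}(∂_y q)q^{−1}, μ̃ := ν, ν̃ := −μ + 2ν. For λ ∈ ℂ∖{0} set U = [[f, λ],[λ, −f]], V = λ^{−1}·[[ (μ+ν)/(2λ), p ],[ q, 0 ]], Ũ = [[f̃, λ],[λ, −f̃]], Ṽ = λ^{−1}·[[ (μ̃+ν̃)/(2λ), p̃ ],[ q̃, 0 ]], and W = [[0, λ],[λ, −ν q^{−1}]]. Then ∂_x W = Ũ W − W U and ∂_y W +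 ((ν−μ)/(2λ)) ∂_λ W = Ṽ W − W V hold for all (x,y) and all λ ≠ 0. -/
/-- For C² solutions of `f_y = p − q`, `p_x = fp + pf − μ`,
`q_x = −fq − qf + ν` with `q` invertible, and the Bäcklund-transformed data
`f̃ = −f + νq⁻¹`, `p̃ = q`, `q̃ = p + νq⁻¹q_y q⁻¹`, `μ̃ = ν`, `ν̃ = −μ + 2ν`, the matrix
`W = [[0, λ],[λ, −νq⁻¹]]` satisfies `∂_x W = Ũ W − W U` and
`∂_y W + ((ν−μ)/(2λ)) ∂_λ W = Ṽ W − W V` for all `(x,y)` and `λ ≠ 0`. -/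
theorem pumped_MB_Backlund_zero_curvature {A : Type*} [NormedRing A] [NormedAlgebra ℂ A]
    [CompleteSpace A] (μ ν : ℂ) (f p q : ℝ × ℝ → A)
    (hf : ContDiff ℝ 2 f) (hp : ContDiff ℝ 2 p) (hq : ContDiff ℝ 2 q)
    (hqu : ∀ v : ℝ × ℝ, IsUnit (q v))
    (hfy : ∀ v : ℝ × ℝ, fderiv ℝ f v (0, 1) = p v - q v)
    (hpx : ∀ v : ℝ × ℝ, fderiv ℝ p v (1, 0) = f v * p v + p v * f v - μ • (1 : A))
    (hqx : ∀ v : ℝ × ℝ, fderiv ℝ q v (1, 0) = -(f v * q v) - q v * f v + ν • (1 : A))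
    (ft pt qt : ℝ × ℝ → A)
    (hft : ∀ v : ℝ × ℝ, ft v = -f v + ν • Ring.inverse (q v))
    (hpt : ∀ v : ℝ × ℝ, pt v = q v)
    (hqt : ∀ v : ℝ × ℝ, qt v
      = p v + ν • (Ring.inverse (q v) * fderiv ℝ q v (0, 1) * Ring.inverse (q v)))
    (U V Ut Vt W : ℝ × ℝ → ℂ → Matrix (Fin 2) (Fin 2) A)
    (hU : ∀ v : ℝ × ℝ, ∀ l : ℂ, U v l = !![f v, l • (1 : A); l • (1 : A), -f v])
    (hV : ∀ v : ℝ × ℝ, ∀ l : ℂ,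
      V v l = l⁻¹ • !![((μ + ν) / (2 * l)) • (1 : A), p v; q v, 0])
    (hUt : ∀ v : ℝ × ℝ, ∀ l : ℂ, Ut v l = !![ft v, l • (1 : A); l • (1 : A), -ft v])
    (hVt : ∀ v : ℝ × ℝ, ∀ l : ℂ,
      Vt v l = l⁻¹ • !![((ν + (-μ + 2 * ν)) / (2 * l)) • (1 : A), pt v; qt v, 0])
    (hW : ∀ v : ℝ × ℝ, ∀ l : ℂ,
      W v l = !![0, l • (1 : A); l • (1 : A), -(ν • Ring.inverse (q v))]) :
    ∀ v : ℝ × ℝ, ∀ l : ℂ, l ≠ 0 → ∀ i j : Fin 2,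
      (fderiv ℝ (fun w => W w l i j) v (1, 0)
          = (Ut v l * W v l - W v l * U v l) i j) ∧
      (fderiv ℝ (fun w => W w l i j) v (0, 1)
            + ((ν - μ) / (2 * l)) • fderiv ℂ (fun m => W v m i j) l 1
          = (Vt v l * W v l - W v l * V v l) i j) := by
  have hd : ∀ v w : ℝ × ℝ, fderiv ℝ (fun w => -(ν • Ring.inverse (q w))) v w
      = ν • (Ring.inverse (q v) * fderiv ℝ q v w * Ring.inverse (q v)) := by
    intro v w
    obtain ⟨u, hu⟩ := hqu v
    have h1 : HasFDerivAt q (fderiv ℝ q v) v :=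
      ((hq.differentiable (by norm_num)) v).hasFDerivAt
    have h2 := hasFDerivAt_ringInverse (𝕜 := ℝ) u
    rw [hu] at h2
    have h3 := ((h2.comp v h1).const_smul ν).neg
    have h4 := h3.fderiv
    have h5 : fderiv ℝ (fun w => -(ν • Ring.inverse (q w))) v = _ := h4
    rw [h5, ← hu, Ring.inverse_unit]
    simp
  have hd2 : ∀ v w : ℝ × ℝ, -(fderiv ℝ (fun y => ν • Ring.inverse (q y)) v) w
      = ν • (Ring.inverse (q v) * fderiv ℝ q v w * Ring.inverse (q v)) := by
    intro v w
    rw [← hd v w, fderiv_fun_neg]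
    rfl
  intro v l hl i j
  have hr1 := Ring.mul_inverse_cancel _ (hqu v)
  have hr2 := Ring.inverse_mul_cancel _ (hqu v)
  have hm : fderiv ℂ (fun m : ℂ => m • (1 : A)) l 1 = 1 := by
    have h := ((hasFDerivAt_id (𝕜 := ℂ) l).smul_const (1 : A)).fderiv
    have h' : fderiv ℂ (fun m : ℂ => m • (1 : A)) l = _ := h
    rw [h']; simp
  have hx : Ring.inverse (q v) * fderiv ℝ q v (1, 0) * Ring.inverse (q v)
      = -(Ring.inverse (q v) * f v) - f v * Ring.inverse (q v)
        + ν • (Ring.inverse (q v) * Ring.inverse (q v)) := by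
    rw [hqx]
    have e1 : Ring.inverse (q v) * (f v * q v) * Ring.inverse (q v)
      = Ring.inverse (q v) * f v := by simp only [mul_assoc, hr1, mul_one]
    have e2 : Ring.inverse (q v) * (q v * f v) * Ring.inverse (q v)
      = f v * Ring.inverse (q v) := by rw [← mul_assoc, hr2, one_mul]
    simp only [mul_add, mul_sub, add_mul, sub_mul, mul_neg, neg_mul, e1, e2]
    simp
  have c1 : l⁻¹ * (l * ((ν + (-μ + 2 * ν)) / (2 * l))) - l⁻¹ * ν = (ν - μ) / (2 * l) := by
    field_simp; ring
  have c2 : l⁻¹ * ν - l⁻¹ * (l * ((μ + ν) / (2 * l))) = (ν - μ) / (2 * l) := by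
    field_simp; ring
  simp only [hW, hU, hV, hUt, hVt]
  fin_cases i <;> fin_cases j <;> constructor
  · simp
  · simp [hpt, hl]
  · simp [hft]
    try module
  · simp [hpt, hl, hm, hr1]
    try (rw [← c1]; module)
  · simp [hft]
    try module
  · simp [hm, hr2]
    try (rw [← c2]; module)
  · simp [hd2, hx, hft, add_mul]
    try module
  · simp [hd2, hqt, hl]
    try module
end

section
/- Let f, p : ℝ² → A be continuously differentiable with p invertible at every point. For λ ∈ ℂ∖{0} define U = [[f, λ],[λ, −f]] and V = λ^{−1}·[[0, p],[p^{−1}, 0]], 2×2 matrices over A. Then the zero curvature equation ∂_y U − ∂_x V = [V, U] holds for all (x,y) and all λ ≠ 0 if and only if f, p satisfy the non-Abelian sinh-Gordon system ∂_y f = p − p^{−1} and ∂_x p = fp + pf. -/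
/-- The zero curvature equation `∂_y U − ∂_x V = [V, U]` with
`U = [[f, λ],[λ, −f]]`, `V = λ⁻¹[[0, p],[p⁻¹, 0]]` holds for all `(x,y)` and `λ ≠ 0`
if and only if `f, p` satisfy the non-Abelian sinh-Gordon system `f_y = p − p⁻¹`,
`p_x = fp + pf`. -/
theorem sinhGordon_zero_curvature {A : Type*} [NormedRing A] [NormedAlgebra ℂ A]
    [CompleteSpace A] (f p : ℝ × ℝ → A)
    (hf : ContDiff ℝ 1 f) (hp : ContDiff ℝ 1 p)
    (hpu : ∀ v : ℝ × ℝ, IsUnit (p v))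
    (U V : ℝ × ℝ → ℂ → Matrix (Fin 2) (Fin 2) A)
    (hU : ∀ v : ℝ × ℝ, ∀ l : ℂ, U v l = !![f v, l • (1 : A); l • (1 : A), -f v])
    (hV : ∀ v : ℝ × ℝ, ∀ l : ℂ,
      V v l = l⁻¹ • !![0, p v; Ring.inverse (p v), 0]) :
    (∀ v : ℝ × ℝ, ∀ l : ℂ, l ≠ 0 → ∀ i j : Fin 2,
        fderiv ℝ (fun w => U w l i j) v (0, 1) - fderiv ℝ (fun w => V w l i j) v (1, 0)
          = (V v l * U v l - U v l * V v l) i j)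
      ↔
    (∀ v : ℝ × ℝ,
        fderiv ℝ f v (0, 1) = p v - Ring.inverse (p v) ∧
        fderiv ℝ p v (1, 0) = f v * p v + p v * f v) := by
  have dp : ∀ v, DifferentiableAt ℝ p v := fun v => (hp.differentiable (by norm_num)) v
  have dq : ∀ v, HasFDerivAt (fun w => Ring.inverse (p w))
      ((-ContinuousLinearMap.mulLeftRight ℝ A (Ring.inverse (p v)) (Ring.inverse (p v))).comp
        (fderiv ℝ p v)) v := by
    intro v
    obtain ⟨u, hu⟩ := hpu v
    have h := hasFDerivAt_ringInverse (𝕜 := ℝ) u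
    rw [← Ring.inverse_unit, hu] at h
    exact h.comp v (dp v).hasFDerivAt
  have e : ∀ v : ℝ × ℝ, ∀ l : ℂ,
      V v l * U v l - U v l * V v l = !![(l⁻¹ * l) • (p v - Ring.inverse (p v)),
        -(l⁻¹ • (f v * p v + p v * f v));
        l⁻¹ • (Ring.inverse (p v) * f v + f v * Ring.inverse (p v)),
        -((l⁻¹ * l) • (p v - Ring.inverse (p v)))] := by
    intro v l
    rw [hU, hV]
    ext i j
    fin_cases i <;> fin_cases j <;>
      simp [Matrix.mul_apply, Fin.sum_univ_two, smul_smul, smul_sub, smul_add, mul_comm l] <;> abel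
  have dsm : ∀ (l : ℂ) (g : ℝ × ℝ → A) (v : ℝ × ℝ) (w : ℝ × ℝ), DifferentiableAt ℝ g v →
      fderiv ℝ (fun w => l • g w) v w = l • fderiv ℝ g v w := by
    intro l g v w hg
    have h : HasFDerivAt (fun w => l • g w) (l • fderiv ℝ g v) v := hg.hasFDerivAt.const_smul l
    rw [h.fderiv]
    rfl
  constructor
  · intro H v
    have h00 := H v 1 one_ne_zero 0 0
    have h01 := H v 1 one_ne_zero 0 1
    rw [e] at h00 h01
    simp [hU, hV] at h00 h01
    refine ⟨h00, ?_⟩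
    rw [← neg_inj, h01]; abel
  · intro H v l hl
    obtain ⟨h1, h2⟩ := H v
    have hq : fderiv ℝ (fun w => Ring.inverse (p w)) v (1, 0)
        = -(Ring.inverse (p v) * f v + f v * Ring.inverse (p v)) := by
      rw [(dq v).fderiv]
      have a := Ring.inverse_mul_cancel _ (hpu v)
      have b := Ring.mul_inverse_cancel _ (hpu v)
      simp only [ContinuousLinearMap.comp_apply, ContinuousLinearMap.neg_apply,
        ContinuousLinearMap.mulLeftRight_apply, h2]
      congr 1
      rw [mul_add, add_mul, ← mul_assoc (Ring.inverse (p v)) (p v), a, one_mul,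
        ← mul_assoc, mul_assoc _ (p v), b, mul_one]
    intro i j
    rw [e, inv_mul_cancel₀ hl]
    fin_cases i <;> fin_cases j
    · simp [hU, hV, h1]
    · simp [hU, hV]
      rw [dsm _ _ _ _ (dp v), h2, smul_add]; try abel
    · simp [hU, hV]
      rw [dsm _ _ _ _ (dq v).differentiableAt, hq]
      simp
      try abel
    · simp [hU, hV, h1, fderiv_fun_neg]
end

section
/- Let a ∈ A and let F, P : ℝ → A be continuously differentiable with P(z) invertible for all z, satisfying the system z F'(z) = (1/2)(P(z) − P(z)^{−1}) − F(z) − [a, F(z)] and P'(z) = F(z)P(z) + P(z)F(z). For z ∈ ℝ and ζ ∈ ℂ∖{0} define the 2×2 matrices over A: M(z,ζ) = [[ (a + zF)/ζ, P/ζ² − z/2 ],[ P^{−1}/ζ² − z/2, (a − zF)/ζ ]] and B(z,ζ) = [[F, −ζ/2],[−ζ/2, −F]]. Then the isomonodromic Lax equation ∂_z M = ∂_ζ B + [B, M] holds for all z ∈ ℝ and all ζ ≠ 0. -/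
/-- If `F, P : ℝ → A` are C¹ with `P` invertible and satisfy
`z F' = (1/2)(P − P⁻¹) − F − [a, F]`, `P' = FP + PF`, then the matrices
`M = [[(a+zF)/ζ, P/ζ² − z/2],[P⁻¹/ζ² − z/2, (a−zF)/ζ]]`, `B = [[F, −ζ/2],[−ζ/2, −F]]`
satisfy the isomonodromic Lax equation `∂_z M = ∂_ζ B + [B, M]` for all `z` and `ζ ≠ 0`. -/
theorem sinhGordon_isomonodromic_Lax {A : Type*} [NormedRing A] [NormedAlgebra ℂ A]
    [CompleteSpace A] (a : A) (F P F' P' : ℝ → A)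
    (hF : ∀ z : ℝ, HasDerivAt F (F' z) z) (hP : ∀ z : ℝ, HasDerivAt P (P' z) z)
    (hF' : Continuous F') (hP' : Continuous P')
    (hPu : ∀ z : ℝ, IsUnit (P z))
    (hODE1 : ∀ z : ℝ, (z : ℂ) • F' z
      = (2 : ℂ)⁻¹ • (P z - Ring.inverse (P z)) - F z - (a * F z - F z * a))
    (hODE2 : ∀ z : ℝ, P' z = F z * P z + P z * F z)
    (M B : ℝ → ℂ → Matrix (Fin 2) (Fin 2) A)
    (hM : ∀ z : ℝ, ∀ ζ : ℂ, M z ζ =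
      !![ζ⁻¹ • (a + (z : ℂ) • F z), (ζ ^ 2)⁻¹ • P z - ((z : ℂ) / 2) • (1 : A);
         (ζ ^ 2)⁻¹ • Ring.inverse (P z) - ((z : ℂ) / 2) • (1 : A),
         ζ⁻¹ • (a - (z : ℂ) • F z)])
    (hB : ∀ z : ℝ, ∀ ζ : ℂ, B z ζ =
      !![F z, (-ζ / 2) • (1 : A); (-ζ / 2) • (1 : A), -F z]) :
    ∀ z : ℝ, ∀ ζ : ℂ, ζ ≠ 0 → ∀ i j : Fin 2,
      HasDerivAt (fun t => M t ζ i j)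
        (fderiv ℂ (fun l => B z l i j) ζ 1 + (B z ζ * M z ζ - M z ζ * B z ζ) i j) z := by
  intro z ζ hζ i j
  have hc : HasDerivAt (fun t : ℝ => (t : ℂ)) 1 z := Complex.ofRealCLM.hasDerivAt
  have hzF : HasDerivAt (fun t : ℝ => (t : ℂ) • F t) ((z : ℂ) • F' z + (1 : ℂ) • F z) z :=
    hc.smul (hF z)
  have hz1 : HasDerivAt (fun t : ℝ => ((t : ℂ) / 2) • (1 : A)) (((1 : ℂ) / 2) • (1 : A)) z :=
    (hc.div_const 2).smul_const (1 : A)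
  have hl : fderiv ℂ (fun l : ℂ => (-l / 2) • (1 : A)) ζ 1 = (-1 / 2 : ℂ) • (1 : A) := by
    have h : HasDerivAt (fun l : ℂ => (-l / 2) • (1 : A)) ((-1 / 2 : ℂ) • (1 : A)) ζ :=
      (((hasDerivAt_id ζ).neg).div_const 2).smul_const (1 : A)
    exact h.deriv
  obtain ⟨u, hu⟩ := hPu z
  have hinv : HasDerivAt (fun t => Ring.inverse (P t))
      (-(Ring.inverse (P z) * F z + F z * Ring.inverse (P z))) z := by
    have h1 : HasFDerivAt Ring.inverse (-ContinuousLinearMap.mulLeftRight ℝ A ↑u⁻¹ ↑u⁻¹) (P z) := by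
      rw [← hu]; exact hasFDerivAt_ringInverse u
    have h2 := h1.comp_hasDerivAt z (hP z)
    refine h2.congr_deriv ?_
    rw [hODE2 z, ← hu]
    simp [mul_add, add_mul, mul_assoc]
  have hO := hODE1 z
  have hO2 := hODE2 z
  have e1 : ζ * (ζ ^ 2)⁻¹ = ζ⁻¹ := by field_simp
  have e2 : ζ * ζ⁻¹ = 1 := by field_simp
  fin_cases i <;> fin_cases j
  · simp only [hM, hB, Matrix.sub_apply, Matrix.mul_apply, Fin.sum_univ_two]
    simp [-Complex.coe_smul, -Complex.real_smul, -smul_add, -smul_sub, -hasDerivAt_const_add_iff]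
    refine ((hzF.const_add a).const_smul ζ⁻¹).congr_deriv ?_
    rw [hO]
    simp only [mul_add, add_mul, mul_sub, sub_mul, smul_mul_assoc, mul_smul_comm, one_mul, mul_one]
    match_scalars <;> field_simp <;> ring
  · simp only [hM, hB, Matrix.sub_apply, Matrix.mul_apply, Fin.sum_univ_two]
    simp [hl, -Complex.coe_smul, -smul_add, -smul_sub]
    refine (((hP z).const_smul (ζ ^ 2)⁻¹).sub hz1).congr_deriv ?_
    rw [hO2]
    simp only [mul_add, add_mul, mul_sub, sub_mul, smul_mul_assoc, mul_smul_comm, one_mul, mul_one]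
    match_scalars <;> field_simp <;> ring
  · simp only [hM, hB, Matrix.sub_apply, Matrix.mul_apply, Fin.sum_univ_two]
    simp [hl, -Complex.coe_smul, -smul_add, -smul_sub]
    refine ((hinv.const_smul (ζ ^ 2)⁻¹).sub hz1).congr_deriv ?_
    simp only [mul_add, add_mul, mul_sub, sub_mul, smul_mul_assoc, mul_smul_comm, one_mul, mul_one]
    match_scalars <;> field_simp <;> ring
  · simp only [hM, hB, Matrix.sub_apply, Matrix.mul_apply, Fin.sum_univ_two]
    simp [-Complex.coe_smul, -Complex.real_smul, -smul_add, -smul_sub, -hasDerivAt_const_add_iff]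
    refine ((hzF.const_sub a).const_smul ζ⁻¹).congr_deriv ?_
    rw [hO]
    simp only [mul_add, add_mul, mul_sub, sub_mul, smul_mul_assoc, mul_smul_comm, one_mul, mul_one]
    match_scalars <;> field_simp <;> ring
end

section
/- Let a ∈ A, μ, ν ∈ ℂ, and let F, P, Q : I → A be continuously differentiable on an interval I ⊆ ℝ with Q(z) invertible for all z ∈ I, satisfying (z F)' = 2P − 2Q + 2[a, F], P' = FP + PF − μ, Q' = −FQ − QF + ν on I. Define P̃ := Q, Q̃ := P − (νz/2)(F Q^{−1} + Q^{−1} F) − (ν/2) Q^{−1} + (ν² z/2) Q^{−2} + ν[a, Q^{−1}], F̃ := −F + ν Q^{−1}, and μ̃ := ν, ν̃ := −μ + 2ν. Then (z F̃)' = 2P̃ − 2Q̃ + 2[a, F̃], P̃' = F̃ P̃ + P̃ F̃ − μ̃, and Q̃' = −F̃ Q̃ − Q̃ F̃ + ν̃ on I. -/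
/-- The Bäcklund transformation `P̃ = Q`,
`Q̃ = P − (νz/2)(FQ⁻¹ + Q⁻¹F) − (ν/2)Q⁻¹ + (ν²z/2)Q⁻² + ν[a, Q⁻¹]`, `F̃ = −F + νQ⁻¹`,
`μ̃ = ν`, `ν̃ = −μ + 2ν` maps solutions of the system
`(zF)' = 2P − 2Q + 2[a,F]`, `P' = FP + PF − μ`, `Q' = −FQ − QF + ν` on an interval `I`
(with `Q` invertible) to solutions of the same system with the new parameters. -/
theorem selfSimilar_system_Backlund {A : Type*} [NormedRing A] [NormedAlgebra ℂ A]
    [CompleteSpace A] (a : A) (μ ν : ℂ) (I : Set ℝ) (hI : I.OrdConnected)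
    (F P Q : ℝ → A) (hQu : ∀ z ∈ I, IsUnit (Q z))
    (hzF : ∀ z ∈ I, HasDerivWithinAt (fun t : ℝ => (t : ℂ) • F t)
      (2 * P z - 2 * Q z + 2 * (a * F z - F z * a)) I z)
    (hP : ∀ z ∈ I, HasDerivWithinAt P (F z * P z + P z * F z - μ • (1 : A)) I z)
    (hQ : ∀ z ∈ I, HasDerivWithinAt Q (-(F z * Q z) - Q z * F z + ν • (1 : A)) I z)
    (Ft Pt Qt : ℝ → A)
    (hFt : ∀ z : ℝ, Ft z = -F z + ν • Ring.inverse (Q z))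
    (hPt : ∀ z : ℝ, Pt z = Q z)
    (hQt : ∀ z : ℝ, Qt z = P z
      - (ν * (z : ℂ) / 2) • (F z * Ring.inverse (Q z) + Ring.inverse (Q z) * F z)
      - (ν / 2) • Ring.inverse (Q z)
      + (ν ^ 2 * (z : ℂ) / 2) • (Ring.inverse (Q z) * Ring.inverse (Q z))
      + ν • (a * Ring.inverse (Q z) - Ring.inverse (Q z) * a)) :
    ∀ z ∈ I,
      HasDerivWithinAt (fun t : ℝ => (t : ℂ) • Ft t)
        (2 * Pt z - 2 * Qt z + 2 * (a * Ft z - Ft z * a)) I z ∧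
      HasDerivWithinAt Pt (Ft z * Pt z + Pt z * Ft z - ν • (1 : A)) I z ∧
      HasDerivWithinAt Qt
        (-(Ft z * Qt z) - Qt z * Ft z + (-μ + 2 * ν) • (1 : A)) I z := by
  intro z hz
  obtain rfl : Pt = Q := funext hPt
  obtain ⟨u, hu⟩ := hQu z hz
  set R : ℝ → A := fun t => Ring.inverse (Pt t) with hRdef
  have hRQ : R z * Pt z = 1 := Ring.inverse_mul_cancel _ (hQu z hz)
  have hQR : Pt z * R z = 1 := Ring.mul_inverse_cancel _ (hQu z hz)
  have hRQ' : ∀ x, R z * (Pt z * x) = x := fun x => by rw [← mul_assoc, hRQ, one_mul]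
  have hQR' : ∀ x, Pt z * (R z * x) = x := fun x => by rw [← mul_assoc, hQR, one_mul]
  have hR : HasDerivWithinAt R (R z * F z + F z * R z - ν • (R z * R z)) I z := by
    have h1 := hasFDerivAt_ringInverse (𝕜 := ℝ) u
    rw [hu] at h1
    have h2 := h1.comp_hasDerivWithinAt z (hQ z hz)
    have hui : (↑u⁻¹ : A) = R z := by
      simp only [hRdef, ← hu, Ring.inverse_unit]
    refine h2.congr_deriv ?_
    rw [neg_apply, ContinuousLinearMap.mulLeftRight_apply]
    simp only [hui,
      mul_add, add_mul, mul_sub, sub_mul, mul_neg, neg_mul, smul_mul_assoc, mul_smul_comm,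
      mul_assoc, hRQ', hQR', hRQ, hQR, mul_one, one_mul]
    abel
  have hz' : HasDerivWithinAt (fun t : ℝ => (t : ℂ)) 1 I z :=
    Complex.ofRealCLM.hasDerivAt.hasDerivWithinAt
  have hG := hzF z hz
  refine ⟨?_, ?_, ?_⟩
  · have e : (fun t : ℝ => (t : ℂ) • Ft t)
        = fun t : ℝ => -((t : ℂ) • F t) + ν • ((t : ℂ) • R t) := by
      funext t
      rw [hFt]
      simp only [hRdef]
      module
    rw [e]
    refine (hG.fun_neg.fun_add ((hz'.fun_smul hR).fun_const_smul ν)).congr_deriv ?_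
    rw [hQt, hFt]
    change _ = 2 * Pt z - 2 * (P z - (ν * (z : ℂ) / 2) • (F z * R z + R z * F z)
      - (ν / 2) • R z + (ν ^ 2 * (z : ℂ) / 2) • (R z * R z) + ν • (a * R z - R z * a))
      + 2 * (a * (-F z + ν • R z) - (-F z + ν • R z) * a)
    simp only [two_mul, mul_add, add_mul, mul_sub, sub_mul, mul_neg, neg_mul, smul_mul_assoc,
      mul_smul_comm, mul_assoc]
    module
  · refine (hQ z hz).congr_deriv ?_
    rw [hFt]
    change _ = (-F z + ν • R z) * Pt z + Pt z * (-F z + ν • R z) - ν • (1 : A)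
    simp only [mul_add, add_mul, mul_neg, neg_mul, smul_mul_assoc, mul_smul_comm, hRQ, hQR]
    module
  · have e : Qt = fun t : ℝ => P t
        - (ν / 2) • (((t : ℂ) • F t) * R t + R t * ((t : ℂ) • F t))
        - (ν / 2) • R t + (ν ^ 2 / 2) • ((t : ℂ) • (R t * R t))
        + ν • (a * R t - R t * a) := by
      funext t
      rw [hQt]
      simp only [hRdef, smul_mul_assoc, mul_smul_comm]
      module
    have hd := ((((hP z hz).fun_sub (((hG.fun_mul hR).fun_add (hR.fun_mul hG)).fun_const_smul
      (ν / 2))).fun_sub (hR.fun_const_smul (ν / 2))).fun_add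
      ((hz'.fun_smul (hR.fun_mul hR)).fun_const_smul (ν ^ 2 / 2))).fun_add
      (((hR.const_mul a).fun_sub (hR.mul_const a)).fun_const_smul ν)
    rw [e]
    refine hd.congr_deriv ?_
    rw [hFt]
    change _ = -((-F z + ν • R z) * _) - _ * (-F z + ν • R z) + _
    simp only [two_mul, mul_add, add_mul, mul_sub, sub_mul, mul_neg, neg_mul, smul_mul_assoc,
      mul_smul_comm, mul_assoc, hRQ', hQR', hRQ, hQR, mul_one, one_mul]
    module
end

section
/- Let a ∈ A, μ, ν, κ ∈ ℂ, and let F, P, Q : I → A be continuously differentiable on an interval I ⊆ ℝ, satisfying (z F)' = 2P − 2Q + 2[a, F], P' = FP + PF − μ, Q' = −FQ − QF + ν on I. For z ∈ I and ζ ∈ ℂ∖{0} define the 2×2 matrices over A: M(z,ζ) = [[ ζ z F − 2ζ a − (μ+ν)/ζ + ζκ, ζ² z − 2P ],[ ζ² z − 2Q, −ζ z F − 2ζ a + ζκ ]] and B(z,ζ) = [[F, ζ],[ζ, −F]]. Then the isomonodromic Lax equation ∂_z M = (ζ² − ν + μ) ∂_ζ B + [B, M] holds for all z ∈ I and all ζ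 ≠ 0. -/
/-- For solutions of `(zF)' = 2P − 2Q + 2[a,F]`, `P' = FP + PF − μ`,
`Q' = −FQ − QF + ν` on an interval `I`, the matrices
`M = [[ζzF − 2ζa − (μ+ν)/ζ + ζκ, ζ²z − 2P],[ζ²z − 2Q, −ζzF − 2ζa + ζκ]]` and
`B = [[F, ζ],[ζ, −F]]` satisfy the isomonodromic Lax equation
`∂_z M = (ζ² − ν + μ) ∂_ζ B + [B, M]` for all `z ∈ I` and `ζ ≠ 0`. -/
theorem selfSimilar_system_isomonodromic_Lax {A : Type*} [NormedRing A]
    [NormedAlgebra ℂ A] [CompleteSpace A] (a : A) (μ ν κ : ℂ)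
    (I : Set ℝ) (hI : I.OrdConnected) (F P Q : ℝ → A)
    (hzF : ∀ z ∈ I, HasDerivWithinAt (fun t : ℝ => (t : ℂ) • F t)
      (2 * P z - 2 * Q z + 2 * (a * F z - F z * a)) I z)
    (hP : ∀ z ∈ I, HasDerivWithinAt P (F z * P z + P z * F z - μ • (1 : A)) I z)
    (hQ : ∀ z ∈ I, HasDerivWithinAt Q (-(F z * Q z) - Q z * F z + ν • (1 : A)) I z)
    (M B : ℝ → ℂ → Matrix (Fin 2) (Fin 2) A)
    (hM : ∀ z : ℝ, ∀ ζ : ℂ, M z ζ =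
      !![(ζ * (z : ℂ)) • F z - (2 * ζ) • a - ((μ + ν) / ζ) • (1 : A) + (ζ * κ) • (1 : A),
         (ζ ^ 2 * (z : ℂ)) • (1 : A) - 2 * P z;
         (ζ ^ 2 * (z : ℂ)) • (1 : A) - 2 * Q z,
         -((ζ * (z : ℂ)) • F z) - (2 * ζ) • a + (ζ * κ) • (1 : A)])
    (hB : ∀ z : ℝ, ∀ ζ : ℂ, B z ζ = !![F z, ζ • (1 : A); ζ • (1 : A), -F z]) :
    ∀ z ∈ I, ∀ ζ : ℂ, ζ ≠ 0 → ∀ i j : Fin 2,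
      HasDerivWithinAt (fun t => M t ζ i j)
        ((ζ ^ 2 - ν + μ) • fderiv ℂ (fun l => B z l i j) ζ 1
          + (B z ζ * M z ζ - M z ζ * B z ζ) i j) I z := by
  intro z hz ζ hζ i j
  have hd : fderiv ℂ (fun l : ℂ => l • (1 : A)) ζ 1 = 1 := by
    have h : HasFDerivAt (fun l : ℂ => l • (1 : A)) _ ζ :=
      (hasFDerivAt_id (𝕜 := ℂ) ζ).smul_const (1 : A)
    rw [h.fderiv]; simp
  have hlin : HasDerivWithinAt (fun t : ℝ => (ζ ^ 2 * (t : ℂ)) • (1 : A))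
      (ζ ^ 2 • (1 : A)) I z := by
    have h1 : HasDerivAt (fun t : ℝ => (t : ℂ)) 1 z := Complex.ofRealCLM.hasDerivAt
    have h2 := ((h1.const_mul (ζ ^ 2)).smul_const (1 : A)).hasDerivWithinAt (s := I)
    simpa using h2
  have hF : HasDerivWithinAt (fun t : ℝ => (ζ * (t : ℂ)) • F t)
      (ζ • (2 * P z - 2 * Q z + 2 * (a * F z - F z * a))) I z := by
    have h := (hzF z hz).const_smul ζ
    refine h.congr_of_mem (fun t _ => ?_) hz
    simp [mul_smul]
  have hc : ζ * ((μ + ν) / ζ) = μ + ν := by field_simp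
  have hc' : (μ + ν) / ζ * ζ = μ + ν := by field_simp
  have hk : ∀ x : A, 2 * x = (2 : ℂ) • x := fun x => by rw [two_mul, two_smul]
  fin_cases i <;> fin_cases j
  · simp only [hM, hB, Matrix.mul_apply, Matrix.sub_apply, Fin.sum_univ_two]
    simp
    refine hF.congr_deriv ?_
    simp only [hk, mul_add, add_mul, mul_sub, sub_mul, smul_mul_assoc, mul_smul_comm, mul_one, one_mul]
    module
  · simp only [hM, hB, Matrix.mul_apply, Matrix.sub_apply, Fin.sum_univ_two]
    simp [hd]
    refine (hlin.sub ((hP z hz).const_mul 2)).congr_deriv ?_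
    simp only [hk, mul_add, add_mul, mul_sub, sub_mul, smul_mul_assoc, mul_smul_comm, mul_one, one_mul, smul_sub, smul_add, smul_smul, hc, hc', mul_neg, neg_mul, smul_neg]
    module
  · simp only [hM, hB, Matrix.mul_apply, Matrix.sub_apply, Fin.sum_univ_two]
    simp [hd]
    refine (hlin.sub ((hQ z hz).const_mul 2)).congr_deriv ?_
    simp only [hk, mul_add, add_mul, mul_sub, sub_mul, smul_mul_assoc, mul_smul_comm, mul_one, one_mul, smul_sub, smul_add, smul_smul, hc, hc', mul_neg, neg_mul, smul_neg]
    module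
  · simp only [hM, hB, Matrix.mul_apply, Matrix.sub_apply, Fin.sum_univ_two]
    simp
    refine hF.neg.congr_deriv ?_
    simp only [hk, mul_add, add_mul, mul_sub, sub_mul, smul_mul_assoc, mul_smul_comm, mul_one, one_mul, mul_neg, neg_mul]
    module
end

section
/- Let a ∈ A, μ ∈ ℂ with μ ≠ 0, κ ∈ ℂ, and let F, P, Q : I → A be continuously differentiable on an interval I ⊆ ℝ with Q(z) invertible for all z ∈ I, satisfying (z F)' = 2P − 2Q + 2[a, F], P' = FP + PF − μ, Q' = −FQ − QF + μ (the system with ν = μ). Define J(z) := 2P(z)Q(z) − μ(z F(z) − 2a − κ). Then: (i) J'(z) = F(z)J(z) − J(z)F(z) for all z ∈ I; (ii) if F̃ := −F + μ Q^{−1}, P̃ := Q, Q̃ := P − (μz/2)(F Q^{−1} + Q^{−1} F) − (μ/2) Q^{−1} + (μ² z/2) Q^{−2} + μ[a, Q^{−1}] are the Bäcklund-transformed variables and J̃(z) := 2P̃(z)Q̃(z) − μ(z F̃(z) − 2a − (κ+1)), then J̃(z) = Q(z) J(z) Q(z)^{−1} for all z ∈ I. -/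
/-- For solutions of the system `(zF)' = 2P − 2Q + 2[a,F]`,
`P' = FP + PF − μ`, `Q' = −FQ − QF + μ` (the case ν = μ ≠ 0) on an interval `I` with `Q`
invertible, the quantity `J := 2PQ − μ(zF − 2a − κ)` satisfies (i) `J' = [F, J]`, and
(ii) for the Bäcklund-transformed variables `F̃ = −F + μQ⁻¹`, `P̃ = Q`,
`Q̃ = P − (μz/2)(FQ⁻¹ + Q⁻¹F) − (μ/2)Q⁻¹ + (μ²z/2)Q⁻² + μ[a,Q⁻¹]` and
`J̃ := 2P̃Q̃ − μ(zF̃ − 2a − (κ+1))` one has `J̃ = Q J Q⁻¹` on `I`. -/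
theorem selfSimilar_partial_first_integral {A : Type*} [NormedRing A] [NormedAlgebra ℂ A]
    [CompleteSpace A] (a : A) (μ κ : ℂ) (hμ : μ ≠ 0)
    (I : Set ℝ) (hI : I.OrdConnected) (F P Q : ℝ → A)
    (hQu : ∀ z ∈ I, IsUnit (Q z))
    (hzF : ∀ z ∈ I, HasDerivWithinAt (fun t : ℝ => (t : ℂ) • F t)
      (2 * P z - 2 * Q z + 2 * (a * F z - F z * a)) I z)
    (hP : ∀ z ∈ I, HasDerivWithinAt P (F z * P z + P z * F z - μ • (1 : A)) I z)
    (hQ : ∀ z ∈ I, HasDerivWithinAt Q (-(F z * Q z) - Q z * F z + μ • (1 : A)) I z)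
    (J : ℝ → A)
    (hJ : ∀ z : ℝ, J z = 2 * P z * Q z - μ • ((z : ℂ) • F z - 2 * a - κ • (1 : A)))
    (Ft Pt Qt Jt : ℝ → A)
    (hFt : ∀ z : ℝ, Ft z = -F z + μ • Ring.inverse (Q z))
    (hPt : ∀ z : ℝ, Pt z = Q z)
    (hQt : ∀ z : ℝ, Qt z = P z
      - (μ * (z : ℂ) / 2) • (F z * Ring.inverse (Q z) + Ring.inverse (Q z) * F z)
      - (μ / 2) • Ring.inverse (Q z)
      + (μ ^ 2 * (z : ℂ) / 2) • (Ring.inverse (Q z) * Ring.inverse (Q z))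
      + μ • (a * Ring.inverse (Q z) - Ring.inverse (Q z) * a))
    (hJt : ∀ z : ℝ, Jt z
      = 2 * Pt z * Qt z - μ • ((z : ℂ) • Ft z - 2 * a - (κ + 1) • (1 : A))) :
    (∀ z ∈ I, HasDerivWithinAt J (F z * J z - J z * F z) I z) ∧
    (∀ z ∈ I, Jt z = Q z * J z * Ring.inverse (Q z)) := by
  constructor
  · intro z hz
    have hJ' : J = fun z : ℝ => 2 * P z * Q z - μ • ((z : ℂ) • F z - 2 * a - κ • (1 : A)) :=
      funext hJ
    have h1 := (((hP z hz).const_mul (2 : A)).mul (hQ z hz)).sub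
      ((((hzF z hz).sub_const (2 * a)).sub_const (κ • (1 : A))).const_smul μ)
    rw [hJ']
    refine h1.congr_deriv ?_
    simp only [two_mul, mul_add, add_mul, mul_sub, sub_mul, smul_add, smul_sub, mul_smul_comm,
      smul_mul_assoc, mul_one, one_mul, mul_assoc, mul_neg, neg_mul]
    abel
  · intro z hz
    have h1 : Q z * Ring.inverse (Q z) = 1 := Ring.mul_inverse_cancel _ (hQu z hz)
    have h1' : ∀ x : A, Q z * (Ring.inverse (Q z) * x) = x := fun x => by
      rw [← mul_assoc, h1, one_mul]
    rw [hJt, hJ, hPt, hFt, hQt]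
    generalize Ring.inverse (Q z) = R at *
    have h2 : (2 : A) = (2 : ℂ) • (1 : A) := by
      rw [← Algebra.algebraMap_eq_smul_one, map_ofNat]
    rw [h2]
    simp only [mul_add, add_mul, mul_sub, sub_mul, mul_smul_comm,
      smul_mul_assoc, mul_one, one_mul, mul_assoc, mul_neg, neg_mul, h1, h1']
    module
end

section
/- Let a ∈ A, μ ∈ ℂ with μ ≠ 0, κ ∈ ℂ, and let F, P : I → A be continuously differentiable on an interval I ⊆ ℝ with P(z) invertible for all z ∈ I, satisfying the system (z F)' = 2P − μ P^{−1}(z F − 2a − κ) + 2[a, F] and P' = FP + PF − μ on I. Define P̃(z) := (μ/2) P(z)^{−1} (z F(z) − 2a − κ) and assume P̃(z) is invertible for all z ∈ I; set F̃ := −F + μ P̃^{−1} and κ̃ := κ + 1. Then (z F̃)' = 2P̃ − μ P̃^{−1}(z F̃ − 2a − κ̃) + 2[a, F̃] and P̃' = F̃ P̃ + P̃ F̃ − μ on I. -/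
theorem aux_inv {A : Type*} [NormedRing A] [NormedAlgebra ℂ A] [CompleteSpace A]
    {I : Set ℝ} {z : ℝ} {P : ℝ → A} {P' : A} (hu : IsUnit (P z))
    (h : HasDerivWithinAt P P' I z) :
    HasDerivWithinAt (fun t => Ring.inverse (P t))
      (-(Ring.inverse (P z) * P' * Ring.inverse (P z))) I z := by
  obtain ⟨u, hu⟩ := hu
  have h1 := hasFDerivAt_ringInverse (𝕜 := ℝ) u
  rw [hu] at h1
  have h2 := h1.comp_hasDerivWithinAt z h
  rw [← hu, Ring.inverse_unit]
  refine HasDerivWithinAt.congr_deriv h2 ?_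
  simp

theorem aux_alg1 {A : Type*} [Ring A] [Algebra ℂ A] (a f p q : A) (μ κ z : ℂ)
    (h1 : p * q = 1) (h2 : q * p = 1) :
    (μ / 2) • (-(q * (f * p + p * f - μ • (1 : A)) * q) * (z • f - 2 * a - κ • (1 : A))
      + q * (2 * p - μ • (q * (z • f - 2 * a - κ • (1 : A))) + 2 * (a * f - f * a)))
    = -(f * ((μ / 2) • (q * (z • f - 2 * a - κ • (1 : A)))))
      - ((μ / 2) • (q * (z • f - 2 * a - κ • (1 : A)))) * f + μ • (1 : A) := by
  have h1' : ∀ x, p * (q * x) = x := fun x => by rw [← mul_assoc, h1, one_mul]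
  have h2' : ∀ x, q * (p * x) = x := fun x => by rw [← mul_assoc, h2, one_mul]
  simp only [two_mul, mul_add, add_mul, mul_sub, sub_mul, neg_mul, mul_neg, mul_assoc,
    smul_mul_assoc, mul_smul_comm, mul_one, one_mul, h1, h2, h1', h2']
  module

theorem aux_alg2 {A : Type*} [Ring A] [Algebra ℂ A] (a f p pt r : A) (μ κ z : ℂ)
    (h1 : pt * r = 1) (h2 : r * pt = 1)
    (h3 : μ • ((z • f - 2 * a - κ • (1 : A)) * r) = 2 * p) :
    -(2 * p - (2 : ℂ) • pt + 2 * (a * f - f * a))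
      + μ • (r + z • -(r * (-(f * pt) - pt * f + μ • (1 : A)) * r))
    = 2 * pt - μ • (r * (z • (-f + μ • r) - 2 * a - (κ + 1) • (1 : A)))
      + 2 * (a * (-f + μ • r) - (-f + μ • r) * a) := by
  have h1' : ∀ x, pt * (r * x) = x := fun x => by rw [← mul_assoc, h1, one_mul]
  have h2' : ∀ x, r * (pt * x) = x := fun x => by rw [← mul_assoc, h2, one_mul]
  rw [← h3]
  simp only [two_mul, mul_add, add_mul, mul_sub, sub_mul, neg_mul, mul_neg, mul_assoc,
    smul_mul_assoc, mul_smul_comm, mul_one, one_mul, h1, h2, h1', h2']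
  module

/-- For solutions of the reduced second order system
`(zF)' = 2P − μP⁻¹(zF − 2a − κ) + 2[a,F]`, `P' = FP + PF − μ` on an interval `I` with `P`
invertible, the Bäcklund transformation `P̃ = (μ/2)P⁻¹(zF − 2a − κ)` (assumed invertible),
`F̃ = −F + μP̃⁻¹`, `κ̃ = κ + 1` yields a solution of the same system:
`(zF̃)' = 2P̃ − μP̃⁻¹(zF̃ − 2a − κ̃) + 2[a,F̃]`, `P̃' = F̃P̃ + P̃F̃ − μ`. -/
theorem nonAbelian_P3_7_Backlund {A : Type*} [NormedRing A] [NormedAlgebra ℂ A]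
    [CompleteSpace A] (a : A) (μ κ : ℂ) (hμ : μ ≠ 0)
    (I : Set ℝ) (hI : I.OrdConnected) (F P : ℝ → A)
    (hPu : ∀ z ∈ I, IsUnit (P z))
    (hzF : ∀ z ∈ I, HasDerivWithinAt (fun t : ℝ => (t : ℂ) • F t)
      (2 * P z - μ • (Ring.inverse (P z) * ((z : ℂ) • F z - 2 * a - κ • (1 : A)))
        + 2 * (a * F z - F z * a)) I z)
    (hP : ∀ z ∈ I, HasDerivWithinAt P (F z * P z + P z * F z - μ • (1 : A)) I z)
    (Pt Ft : ℝ → A)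
    (hPt : ∀ z : ℝ, Pt z
      = (μ / 2) • (Ring.inverse (P z) * ((z : ℂ) • F z - 2 * a - κ • (1 : A))))
    (hPtu : ∀ z ∈ I, IsUnit (Pt z))
    (hFt : ∀ z : ℝ, Ft z = -F z + μ • Ring.inverse (Pt z)) :
    ∀ z ∈ I,
      HasDerivWithinAt (fun t : ℝ => (t : ℂ) • Ft t)
        (2 * Pt z
          - μ • (Ring.inverse (Pt z) * ((z : ℂ) • Ft z - 2 * a - (κ + 1) • (1 : A)))
          + 2 * (a * Ft z - Ft z * a)) I z ∧
      HasDerivWithinAt Pt (Ft z * Pt z + Pt z * Ft z - μ • (1 : A)) I z := by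
  intro z hz
  have q1 := Ring.mul_inverse_cancel _ (hPu z hz)
  have q2 := Ring.inverse_mul_cancel _ (hPu z hz)
  have r1 := Ring.mul_inverse_cancel _ (hPtu z hz)
  have r2 := Ring.inverse_mul_cancel _ (hPtu z hz)
  have hG := ((hzF z hz).sub_const (2 * a)).sub_const (κ • (1 : A))
  have hD : HasDerivWithinAt Pt (-(F z * Pt z) - Pt z * F z + μ • (1 : A)) I z := by
    have h := (((aux_inv (hPu z hz) (hP z hz)).mul hG).const_smul (μ / 2))
    have e := aux_alg1 a (F z) (P z) (Ring.inverse (P z)) μ κ z q1 q2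
    rw [← hPt z] at e
    rw [← e]
    exact h.congr (fun t _ => hPt t) (hPt z)
  refine ⟨?_, ?_⟩
  · have h3 : μ • (((z : ℂ) • F z - 2 * a - κ • (1 : A)) * Ring.inverse (Pt z)) = 2 * P z := by
      have e : μ • ((z : ℂ) • F z - 2 * a - κ • (1 : A)) = 2 * P z * Pt z := by
        rw [hPt z]
        generalize (z : ℂ) • F z - 2 * a - κ • (1 : A) = G
        rw [mul_smul_comm, mul_assoc, ← mul_assoc (P z), q1, one_mul, two_mul]
        module
      rw [← smul_mul_assoc, e, mul_assoc, r1, mul_one]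
    have e := aux_alg2 a (F z) (P z) (Pt z) (Ring.inverse (Pt z)) μ κ z r1 r2 h3
    rw [← hFt z] at e
    rw [← e]
    have hc : HasDerivWithinAt (fun t : ℝ => (t : ℂ)) 1 I z :=
      (Complex.ofRealCLM.hasDerivAt (x := z)).hasDerivWithinAt
    have hR := (hc.smul (aux_inv (hPtu z hz) hD)).const_smul μ
    have hS := (hzF z hz).neg.add hR
    have e2 : (2 : ℂ) • Pt z = μ • (Ring.inverse (P z) * ((z : ℂ) • F z - 2 * a - κ • (1 : A))) := by
      rw [hPt z]
      module
    rw [e2]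
    refine (hS.congr_deriv ?_).congr (fun t _ => ?_) ?_
    · rw [one_smul, add_comm (Ring.inverse (Pt z))]
    · change (t : ℂ) • Ft t = -((t : ℂ) • F t) + μ • ((t : ℂ) • Ring.inverse (Pt t))
      rw [hFt t]
      module
    · change (z : ℂ) • Ft z = -((z : ℂ) • F z) + μ • ((z : ℂ) • Ring.inverse (Pt z))
      rw [hFt z]
      module
  · refine hD.congr_deriv ?_
    rw [hFt z, add_mul, mul_add, smul_mul_assoc, mul_smul_comm, r1, r2, neg_mul, mul_neg]
    abel
end

section
/- Let a, κ, μ ∈ ℂ with μ ≠ 0, and let f, p : I → ℂ be continuously differentiable on an interval I ⊆ ℝ with 0 ∉ I and p(z) ≠ 0 for all z ∈ I, satisfying the scalar system (z f)' = 2p − μ p^{−1}(z f − 2a − κ) and p' = 2fp − μ on I. Then p is twice differentiable and satisfies the Painlevé III equation p'' = (p')²/p − p'/z + (4p² + μ(4a − 1 + 2κ))/z − μ²/p on I, i.e., equation P₃ with parameters α = 4, β = μ(4a − 1 + 2κ), γ = 0, δ = −μ² (the case P₃^{(7)}). -/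
/-- In the scalar case, solutions of
`(zf)' = 2p − μp⁻¹(zf − 2a − κ)`, `p' = 2fp − μ` on an interval `I` with `0 ∉ I` and
`p ≠ 0` satisfy (with `p' = 2fp − μ`) the Painlevé III equation
`p'' = (p')²/p − p'/z + (4p² + μ(4a − 1 + 2κ))/z − μ²/p`
(P₃ with α = 4, β = μ(4a−1+2κ), γ = 0, δ = −μ², the case P₃^{(7)}). -/
theorem scalar_P3_7 (a κ μ : ℂ) (hμ : μ ≠ 0)
    (I : Set ℝ) (hI : I.OrdConnected) (h0 : (0 : ℝ) ∉ I)
    (f p : ℝ → ℂ) (hpne : ∀ z ∈ I, p z ≠ 0)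
    (hzf : ∀ z ∈ I, HasDerivWithinAt (fun t : ℝ => (t : ℂ) * f t)
      (2 * p z - μ * (p z)⁻¹ * ((z : ℂ) * f z - 2 * a - κ)) I z)
    (hp : ∀ z ∈ I, HasDerivWithinAt p (2 * f z * p z - μ) I z) :
    ∀ z ∈ I,
      HasDerivWithinAt (fun t : ℝ => 2 * f t * p t - μ)
        ((2 * f z * p z - μ) ^ 2 / p z - (2 * f z * p z - μ) / (z : ℂ)
          + (4 * (p z) ^ 2 + μ * (4 * a - 1 + 2 * κ)) / (z : ℂ)
          - μ ^ 2 / p z) I z := by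
  intro z hz
  have hne : ∀ t ∈ I, (t : ℂ) ≠ 0 := by
    intro t ht h
    have h2 : t = 0 := by exact_mod_cast h
    exact h0 (h2 ▸ ht)
  have hz0 := hne z hz
  have hpz := hpne z hz
  have hid : HasDerivWithinAt (fun t : ℝ => (t : ℂ)) 1 I z :=
    (Complex.ofRealCLM.hasDerivAt (x := z)).hasDerivWithinAt
  have hq := ((((hzf z hz).div hid hz0).const_mul 2).mul (hp z hz)).sub_const μ
  refine (hq.congr_deriv ?_).congr_of_mem ?_ hz
  · simp only [Pi.div_apply]
    field_simp
    ring
  · intro t ht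
    have := hne t ht
    simp only [Pi.mul_apply, Pi.div_apply]
    field_simp
end

section
/- Let ε, μ, κ ∈ ℂ with ε ≠ 0, and let f, p : I → ℂ be continuously differentiable on an interval I ⊆ ℝ with 0 ∉ I, satisfying the scalar system (z f)' = 2p − εz + ε(z f − κ)(z f + κ − 2μ/ε − 1)/(2p − εz) and p' = 2fp − μ on I, where 2p(z) − εz ≠ 0 for all z ∈ I. Assume moreover that z p'(z) − 2κ p(z) + μ z ≠ 0 and p(z) ≠ 0 on I, and define w(z) := 2p(z)(2p(z) − εz)/(z p'(z) − 2κ p(z) + μ z). Then w satisfies the Painlevé III equation w'' = (w')²/w − w'/z + (α w² + β)/z + γ w³ + δ/w on I with parameters α = −2κ − 1, β = ε(2κ − 1) − 4μ, γ = 1, δ = −ε² (the generic case P₃^{(6)}). -/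
/-- In the scalar case, for solutions of
`(zf)' = 2p − εz + ε(zf − κ)(zf + κ − 2μ/ε − 1)/(2p − εz)`, `p' = 2fp − μ` on an interval
`I` with `0 ∉ I`, `2p − εz ≠ 0`, `p ≠ 0` and `zp' − 2κp + μz ≠ 0` (where `p' = 2fp − μ`),
the function `w := 2p(2p − εz)/(zp' − 2κp + μz)` satisfies the Painlevé III equation
`w'' = (w')²/w − w'/z + (αw² + β)/z + γw³ + δ/w` with `α = −2κ − 1`,
`β = ε(2κ − 1) − 4μ`, `γ = 1`, `δ = −ε²` (the generic case P₃^{(6)}). -/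
theorem scalar_P3_6 (ε μ κ : ℂ) (hε : ε ≠ 0)
    (I : Set ℝ) (hI : I.OrdConnected) (h0 : (0 : ℝ) ∉ I)
    (f p : ℝ → ℂ)
    (hpne : ∀ z ∈ I, p z ≠ 0)
    (h2p : ∀ z ∈ I, 2 * p z - ε * (z : ℂ) ≠ 0)
    (hden : ∀ z ∈ I, (z : ℂ) * (2 * f z * p z - μ) - 2 * κ * p z + μ * (z : ℂ) ≠ 0)
    (hzf : ∀ z ∈ I, HasDerivWithinAt (fun t : ℝ => (t : ℂ) * f t)
      (2 * p z - ε * (z : ℂ)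
        + ε * ((z : ℂ) * f z - κ) * ((z : ℂ) * f z + κ - 2 * μ / ε - 1)
          / (2 * p z - ε * (z : ℂ))) I z)
    (hp : ∀ z ∈ I, HasDerivWithinAt p (2 * f z * p z - μ) I z)
    (w : ℝ → ℂ)
    (hw : ∀ z : ℝ, w z = 2 * p z * (2 * p z - ε * (z : ℂ))
      / ((z : ℂ) * (2 * f z * p z - μ) - 2 * κ * p z + μ * (z : ℂ))) :
    ∃ w' : ℝ → ℂ,
      (∀ z ∈ I, HasDerivWithinAt w (w' z) I z) ∧
      (∀ z ∈ I, HasDerivWithinAt w'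
        ((w' z) ^ 2 / w z - w' z / (z : ℂ)
          + ((-2 * κ - 1) * (w z) ^ 2 + (ε * (2 * κ - 1) - 4 * μ)) / (z : ℂ)
          + (w z) ^ 3 - ε ^ 2 / w z) I z) := by
  have hz : ∀ z ∈ I, (z : ℂ) ≠ 0 := by
    intro z hzI h
    apply h0
    have : z = 0 := by exact_mod_cast h
    rwa [← this]
  have hdd : ∀ z : ℝ, (z : ℂ) * (2 * f z * p z - μ) - 2 * κ * p z + μ * (z : ℂ)
      = 2 * p z * ((z : ℂ) * f z - κ) := by
    intro z; ring
  have hu : ∀ z ∈ I, (z : ℂ) * f z - κ ≠ 0 := by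
    intro z hzI h
    apply hden z hzI
    rw [hdd, h, mul_zero]
  have hweq : ∀ z ∈ I, w z = (2 * p z - ε * (z : ℂ)) / ((z : ℂ) * f z - κ) := by
    intro z hzI
    rw [hw, hdd]
    exact mul_div_mul_left _ _ (mul_ne_zero two_ne_zero (hpne z hzI))
  have hid : ∀ z : ℝ, HasDerivWithinAt (fun t : ℝ => (t : ℂ)) 1 I z := by
    intro z
    exact ((hasDerivAt_id z).ofReal_comp).hasDerivWithinAt
  have hw1 : ∀ z ∈ I, HasDerivWithinAt w
      (2 * ((z : ℂ) * f z) * w z / (z : ℂ) - (w z) ^ 2 + ε) I z := by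
    intro z hzI
    have h1 := (((hp z hzI).const_mul 2).sub ((hid z).const_mul ε)).div
      ((hzf z hzI).sub_const κ) (hu z hzI)
    refine (h1.congr (fun t ht => hweq t ht) (hweq z hzI)).congr_deriv ?_
    rw [hweq z hzI]
    have a := hz z hzI
    have b := hu z hzI
    have c := h2p z hzI
    simp only [Pi.sub_apply]
    generalize hq : 2 * p z - ε * (z : ℂ) = q at *
    generalize hg : (z : ℂ) * f z - κ = u at *
    have e1 : p z = (q + ε * z) / 2 := by rw [← hq]; ring
    have e2 : f z = (u + κ) / z := by rw [← hg]; field_simp; ring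
    rw [e1, e2]
    field_simp
    ring
  refine ⟨fun z => 2 * ((z : ℂ) * f z) * w z / (z : ℂ) - (w z) ^ 2 + ε, hw1, ?_⟩
  intro z hzI
  have h2 := (((((hzf z hzI).const_mul 2).mul (hw1 z hzI)).div (hid z) (hz z hzI)).sub
    ((hw1 z hzI).pow 2)).add_const ε
  refine h2.congr_deriv ?_
  have a := hz z hzI
  have b := hu z hzI
  have c := h2p z hzI
  have d := hweq z hzI
  have hwne : w z ≠ 0 := by rw [d]; exact div_ne_zero c b
  have hq : 2 * p z - ε * (z : ℂ) = w z * ((z : ℂ) * f z - κ) := by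
    rw [d]; field_simp
  simp only [Pi.mul_apply]
  rw [hq]
  generalize w z = W at *
  have e2 : f z = (((z : ℂ) * f z - κ) + κ) / z := by field_simp; ring
  generalize (z : ℂ) * f z - κ = u at *
  rw [e2]
  push_cast
  field_simp
  ring
end
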